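/- Let n ≥ 2, let 1 ≤ a < n, set t = gcd(2n, a), let K be a field, and let S = K[V(C_{2n}(a,n))]. (a) If 2n/t is even, then pdim(S/I(C_{2n}(a,n))) = 2n − ⌈n/(2t)⌉ · t if n/t ≡ 1 (mod 4), and pdim(S/I(C_{2n}(a,n))) = 2n − ⌈(n−t)/(2t)⌉ · t otherwise. (b) If 2n/t is odd, then pdim(S/I(C_{2n}(a,n))) = 2n − ⌈(2n−t)/(2t)⌉ · (t/2) if 2n/t ≡ 1 (mod 4), and pdim(S/I(C_{2n}(a,n))) = 2n − ⌈n/t⌉ · (t/2) if 2n/t ≡ 3 (mod 4). -/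

import Mathlib

open MvPolynomial

/-- The edge ideal of a simple graph `G`, inside `K[x_v : v ∈ V]`. -/
noncomputable def edgeIdeal (K : Type*) [Field K] {V : Type*} (G : SimpleGraph V) :
    Ideal (MvPolynomial V K) :=
  Ideal.span {m | ∃ i j : V, G.Adj i j ∧ m = X i * X j}

/-- The graded maximal ideal of `K[x_v : v ∈ V]`. -/
noncomputable def maxIdeal (K : Type*) [Field K] (V : Type*) : Ideal (MvPolynomial V K) :=
  Ideal.span (Set.range (X : V → MvPolynomial V K))

/-- depth of `S/I` over `S = K[x_v]`: the supremum of lengths of regular sequences on `S/I`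
consisting of elements of the graded maximal ideal. -/
noncomputable def depthQuot {K : Type*} [Field K] {V : Type*} (I : Ideal (MvPolynomial V K)) : ℕ :=
  sSup {n : ℕ | ∃ rs : List (MvPolynomial V K), rs.length = n ∧
    (∀ r ∈ rs, r ∈ maxIdeal K V) ∧
    RingTheory.Sequence.IsRegular (MvPolynomial V K ⧸ I) rs}

/-- The Stanley space `u·K[Z]` inside `S/I`, as a `K`-subspace. -/
noncomputable def stanleySpace {K : Type*} [Field K] {V : Type*}
    (I : Ideal (MvPolynomial V K)) (u : V →₀ ℕ) (Z : Finset V) :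
    Submodule K (MvPolynomial V K ⧸ I) :=
  Submodule.span K
    {x | ∃ a : V →₀ ℕ, a.support ⊆ Z ∧ x = Ideal.Quotient.mk I (monomial (u + a) (1 : K))}

/-- A Stanley decomposition of `S/I`: a finite family of Stanley spaces `u_j K[Z_j]`,
each of which is a free `K[Z_j]`-module (expressed by linear independence of the monomial
spanning set), whose internal direct sum is all of `S/I`. -/
structure StanleyDecomposition {K : Type*} [Field K] {V : Type*}
    (I : Ideal (MvPolynomial V K)) : Type _ where
  m : ℕ
  u : Fin m → (V →₀ ℕ)
  Z : Fin m → Finset V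
  free : ∀ j : Fin m, LinearIndependent K
    (fun a : {a : V →₀ ℕ // a.support ⊆ Z j} =>
      Ideal.Quotient.mk I (monomial (u j + (a : V →₀ ℕ)) (1 : K)))
  internal : DirectSum.IsInternal (fun j : Fin m => stanleySpace I (u j) (Z j))

/-- The Stanley depth of `S/I`. -/
noncomputable def sdepthQuot {K : Type*} [Field K] {V : Type*}
    (I : Ideal (MvPolynomial V K)) : ℕ :=
  sSup {n : ℕ | ∃ D : StanleyDecomposition I, ∀ j, n ≤ (D.Z j).card}

/-- `pdimLE R n M`: the `R`-module `M` has projective dimension at most `n`,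
i.e. it admits a projective resolution of length `n`. -/
def pdimLE (R : Type*) [CommRing R] :
    (n : ℕ) → (M : Type*) → [AddCommGroup M] → [Module R M] → Prop
  | 0, M, _, _ => Module.Projective R M
  | (n+1), M, _, _ => ∃ (P : Type _) (_ : AddCommGroup P) (_ : Module R P)
      (f : P →ₗ[R] M), Module.Projective R P ∧ Function.Surjective f ∧
        pdimLE R n (LinearMap.ker f)

/-- The projective dimension of `S/I` over `S`: the length of a minimal (projective/free)
resolution, i.e. the least `n` such that `S/I` has a projective resolution of length `n`. -/
noncomputable def pdimQuot {K : Type*} [Field K] {V : Type*}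
    (I : Ideal (MvPolynomial V K)) : ℕ :=
  sInf {n : ℕ | pdimLE (MvPolynomial V K) n (MvPolynomial V K ⧸ I)}

/-- The ladder graph `A n` on `2n` vertices: `inl i = x_{i+1}`, `inr i = y_{i+1}`. -/
def graphA (n : ℕ) : SimpleGraph (Fin n ⊕ Fin n) :=
  SimpleGraph.fromRel (fun a b =>
    match a, b with
    | .inl i, .inl j => (i : ℕ) + 1 = j
    | .inr i, .inr j => (i : ℕ) + 1 = j
    | .inl i, .inr j => (i : ℕ) = (j : ℕ)
    | .inr _, .inl _ => False)

/-- The graph `B n`: the ladder `A n` with one extra vertex `y_{n+1}` and edge `{y_n, y_{n+1}}`.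
Here `inl i = x_{i+1}` (`i < n`) and `inr i = y_{i+1}` (`i < n+1`). -/
def graphB (n : ℕ) : SimpleGraph (Fin n ⊕ Fin (n+1)) :=
  SimpleGraph.fromRel (fun a b =>
    match a, b with
    | .inl i, .inl j => (i : ℕ) + 1 = j
    | .inr i, .inr j => (i : ℕ) + 1 = j
    | .inl i, .inr j => (i : ℕ) = (j : ℕ)
    | .inr _, .inl _ => False)

/-- The graph `C n`: the ladder `A n` with two extra vertices `y_{n+1}, y_{n+2}` and extra
edges `{y_n, y_{n+1}}` and `{y_1, y_{n+2}}`. Here `inl i = x_{i+1}` (`i < n`) and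
`inr i = y_{i+1}` (`i < n+2`). -/
def graphC (n : ℕ) : SimpleGraph (Fin n ⊕ Fin (n+2)) :=
  SimpleGraph.fromRel (fun a b =>
    match a, b with
    | .inl i, .inl j => (i : ℕ) + 1 = j
    | .inr i, .inr j => ((i : ℕ) + 1 = j ∧ (j : ℕ) ≤ n) ∨ ((i : ℕ) = 0 ∧ (j : ℕ) = n + 1)
    | .inl i, .inr j => (i : ℕ) = (j : ℕ)
    | .inr _, .inl _ => False)

/-- The graph `D n`: the ladder `A n` with two extra vertices `x_{n+1}, y_{n+1}` and extra
edges `{y_n, y_{n+1}}` and `{x_1, x_{n+1}}`. Here `inl i = x_{i+1}` and `inr i = y_{i+1}`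
(`i < n+1`). -/
def graphD (n : ℕ) : SimpleGraph (Fin (n+1) ⊕ Fin (n+1)) :=
  SimpleGraph.fromRel (fun a b =>
    match a, b with
    | .inl i, .inl j => ((i : ℕ) + 1 = j ∧ (j : ℕ) ≤ n - 1) ∨ ((i : ℕ) = 0 ∧ (j : ℕ) = n)
    | .inr i, .inr j => (i : ℕ) + 1 = j
    | .inl i, .inr j => (i : ℕ) = (j : ℕ) ∧ (i : ℕ) ≤ n - 1
    | .inr _, .inl _ => False)

/-- The circulant graph `C_q(s)` on vertex set `{x_1, …, x_q}` (realized as `Fin q`):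
`x_i` and `x_j` are adjacent iff `|i - j| ∈ s` or `q - |i - j| ∈ s`. -/
def circulantGraph (q : ℕ) (s : Set ℕ) : SimpleGraph (Fin q) :=
  SimpleGraph.fromRel (fun i j =>
    ((i : ℤ) - (j : ℤ)).natAbs ∈ s ∨ q - ((i : ℤ) - (j : ℤ)).natAbs ∈ s)


set_option linter.unusedSectionVars false
set_option linter.unusedSimpArgs false

/-! ### Projective dimension: bridge to Mathlib -/

section PdimBridge

universe u
open CategoryTheory

theorem pdimLE_iff_hasPD {R : Type u} [CommRing R] (n : ℕ) :
    ∀ (M : Type u) [AddCommGroup M] [Module R M],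
      pdimLE R n M ↔ HasProjectiveDimensionLT (ModuleCat.of R M) (n + 1) := by
  induction n with
  | zero =>
    intro M _ _
    rw [zero_add, ← projective_iff_hasProjectiveDimensionLT_one]
    exact IsProjective.iff_projective M
  | succ n ih =>
    intro M _ _
    constructor
    · rintro ⟨P, _, _, f, hP, hf, hk⟩
      have hS := LinearMap.shortExact_shortComplexKer hf
      have h1 := (ih (LinearMap.ker f)).1 hk
      have : Projective (ModuleCat.of R P) := (IsProjective.iff_projective P).1 hP
      have h2 : HasProjectiveDimensionLT (ModuleCat.of R P) (n + 1 + 1) := inferInstance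
      exact hS.hasProjectiveDimensionLT_X₃ (n + 1) h1 h2
    · intro h
      refine ⟨M →₀ R, inferInstance, inferInstance, Finsupp.linearCombination R id, inferInstance,
        Finsupp.linearCombination_id_surjective R M, ?_⟩
      have hS := LinearMap.shortExact_shortComplexKer (Finsupp.linearCombination_id_surjective R M)
      have : Projective (ModuleCat.of R (M →₀ R)) :=
        (IsProjective.iff_projective _).1 inferInstance
      have h2 : HasProjectiveDimensionLT (ModuleCat.of R (M →₀ R)) (n + 1) := inferInstance
      rw [ih]
      exact hS.hasProjectiveDimensionLT_X₁ (n + 1) h2 h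

theorem pdimLE_mono {R : Type u} [CommRing R] {n k : ℕ} (h : n ≤ k)
    (M : Type u) [AddCommGroup M] [Module R M] (hM : pdimLE R n M) : pdimLE R k M := by
  rw [pdimLE_iff_hasPD] at hM ⊢
  exact hasProjectiveDimensionLT_of_ge _ (n + 1) _ (by omega)

variable {R : Type u} [CommRing R] {A B C : Type u} [AddCommGroup A] [Module R A]
  [AddCommGroup B] [Module R B] [AddCommGroup C] [Module R C]
  (f : A →ₗ[R] B) (g : B →ₗ[R] C)

theorem pdimLE_mid (hf : Function.Injective f) (hg : Function.Surjective g)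
    (hfg : Function.Exact f g) {n : ℕ} (hA : pdimLE R n A) (hC : pdimLE R n C) :
    pdimLE R n B := by
  rw [pdimLE_iff_hasPD] at *
  have hS := ModuleCat.shortComplex_shortExact
    (ShortComplex.mk (ModuleCat.ofHom f) (ModuleCat.ofHom g) (by
      ext x; exact hfg.apply_apply_eq_zero x)) hfg hf hg
  exact hS.hasProjectiveDimensionLT_X₂ _ hA hC

theorem pdimLE_right (hf : Function.Injective f) (hg : Function.Surjective g)
    (hfg : Function.Exact f g) {n : ℕ} (hA : pdimLE R n A) (hB : pdimLE R n B) :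
    pdimLE R (n + 1) C := by
  have hB' := pdimLE_mono (Nat.le_succ n) _ hB
  rw [pdimLE_iff_hasPD] at *
  have hS := ModuleCat.shortComplex_shortExact
    (ShortComplex.mk (ModuleCat.ofHom f) (ModuleCat.ofHom g) (by
      ext x; exact hfg.apply_apply_eq_zero x)) hfg hf hg
  exact hS.hasProjectiveDimensionLT_X₃ _ hA hB'

end PdimBridge

/-! ### The game -/

section Game

variable {V : Type} [DecidableEq V]

/-- removing the neighbours of `x` -/
noncomputable def delN (G : SimpleGraph V) (R : Finset V) (x : V) : Finset V :=
  open Classical in R.filter (fun v => ¬ G.Adj x v)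

theorem mem_delN {G : SimpleGraph V} {R : Finset V} {x v : V} :
    v ∈ delN G R x ↔ v ∈ R ∧ ¬ G.Adj x v := by
  simp [delN]

/-- The combinatorial game certifying lower bounds for the depth. -/
inductive Win (G : SimpleGraph V) : Finset V → ℕ → Prop
  | leaf (R : Finset V) (d : ℕ) (h : ∀ u ∈ R, ∀ v ∈ R, ¬ G.Adj u v) (hd : d ≤ R.card) : Win G R d
  | step (R : Finset V) (d : ℕ) (x : V) (hx : x ∈ R) (h1 : Win G (R.erase x) d)
      (h2 : Win G (delN G R x) d) : Win G R d

end Game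

/-! ### The ideals `J R = I(G) + (x_v : v ∉ R)` -/

section UpperBound

variable {V : Type} [Fintype V] [DecidableEq V]

/-- `I(G) + (x_v : v ∉ R)` -/
noncomputable def Jid (K : Type*) [Field K] (G : SimpleGraph V) (R : Finset V) :
    Ideal (MvPolynomial V K) :=
  Ideal.span ((fun s => monomial s (1 : K)) ''
    ({s | ∃ v, v ∉ R ∧ s = Finsupp.single v 1} ∪
     {s | ∃ i j, G.Adj i j ∧ s = Finsupp.single i 1 + Finsupp.single j 1}))

theorem mem_Jid {K : Type*} [Field K] {G : SimpleGraph V} {R : Finset V}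
    {f : MvPolynomial V K} : f ∈ Jid K G R ↔ ∀ m ∈ f.support,
      (∃ v, v ∉ R ∧ m v ≠ 0) ∨ (∃ i j, G.Adj i j ∧ m i ≠ 0 ∧ m j ≠ 0) := by
  unfold Jid
  rw [mem_ideal_span_monomial_image]
  refine forall₂_congr fun m _ => ?_
  constructor
  · rintro ⟨s, ⟨v, hv, rfl⟩ | ⟨i, j, hij, rfl⟩, hs⟩
    · left
      refine ⟨v, hv, ?_⟩
      have := hs v
      simp at this; omega
    · right
      refine ⟨i, j, hij, ?_, ?_⟩
      · have := hs i
        simp at this; omega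
      · have := hs j
        simp at this; omega
  · rintro (⟨v, hv, h⟩ | ⟨i, j, hij, hi, hj⟩)
    · refine ⟨_, Or.inl ⟨v, hv, rfl⟩, ?_⟩
      intro w
      by_cases hw : v = w
      · subst hw; simp; omega
      · simp [Finsupp.single_apply, hw]
    · refine ⟨_, Or.inr ⟨i, j, hij, rfl⟩, ?_⟩
      intro w
      have hne := hij.ne
      simp only [Finsupp.coe_add, Pi.add_apply, Finsupp.single_apply]
      split_ifs with h1 h2 h2
      · exact absurd (h1.trans h2.symm) hne
      · subst h1; omega
      · subst h2; omega
      · omega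

theorem edgeIdeal_eq_Jid (K : Type*) [Field K] (G : SimpleGraph V) :
    edgeIdeal K G = Jid K G Finset.univ := by
  unfold edgeIdeal Jid
  congr 1
  ext m
  simp only [Set.mem_ofPred_eq, Finset.mem_univ, not_true_eq_false, false_and, exists_false,
    Set.ofPred_false, Set.empty_union, Set.mem_image]
  constructor
  · rintro ⟨i, j, h, rfl⟩
    exact ⟨_, ⟨i, j, h, rfl⟩, by simp [X, monomial_mul]⟩
  · rintro ⟨s, ⟨i, j, h, rfl⟩, rfl⟩
    exact ⟨i, j, h, by simp [X, monomial_mul]⟩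

theorem X_mul_mem_Jid {K : Type*} [Field K] {G : SimpleGraph V} {R : Finset V} {x : V}
    (hx : x ∈ R) {f : MvPolynomial V K} :
    X x * f ∈ Jid K G R ↔ f ∈ Jid K G (delN G R x) := by
  rw [mem_Jid, mem_Jid]
  have hs : (X x * f).support = f.support.map (addLeftEmbedding (Finsupp.single x 1)) :=
    support_X_mul x f
  rw [hs]
  simp only [Finset.mem_map, addLeftEmbedding_apply, forall_exists_index, and_imp,
    forall_apply_eq_imp_iff₂]
  refine forall₂_congr fun m _ => ?_
  have key : ∀ v, (Finsupp.single x 1 + m : V →₀ ℕ) v ≠ 0 ↔ (x = v ∨ m v ≠ 0) := by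
    intro v
    by_cases h : x = v
    · subst h; simp
    · simp [h, Finsupp.single_apply]
  simp only [key, mem_delN]
  constructor
  · rintro (⟨v, hv, rfl | h⟩ | ⟨i, j, hij, h1, h2⟩)
    · exact absurd hx hv
    · exact Or.inl ⟨v, fun h' => hv h'.1, h⟩
    · rcases h1 with rfl | h1
      · rcases h2 with rfl | h2
        · exact absurd rfl hij.ne
        · exact Or.inl ⟨j, fun h' => h'.2 hij, h2⟩
      · rcases h2 with rfl | h2
        · exact Or.inl ⟨i, fun h' => h'.2 hij.symm, h1⟩
        · exact Or.inr ⟨i, j, hij, h1, h2⟩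
  · rintro (⟨v, hv, h⟩ | ⟨i, j, hij, h1, h2⟩)
    · by_cases hR : v ∈ R
      · have : G.Adj x v := by by_contra h'; exact hv ⟨hR, h'⟩
        exact Or.inr ⟨x, v, this, Or.inl rfl, Or.inr h⟩
      · exact Or.inl ⟨v, hR, Or.inr h⟩
    · exact Or.inr ⟨i, j, hij, Or.inr h1, Or.inr h2⟩

theorem Jid_erase (K : Type*) [Field K] (G : SimpleGraph V) (R : Finset V) (x : V) :
    Jid K G (R.erase x) = Jid K G R ⊔ Ideal.span {X x} := by
  unfold Jid
  rw [← Ideal.span_union]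
  apply le_antisymm
  · apply Ideal.span_le.2
    rintro _ ⟨s, ⟨v, hv, rfl⟩ | hs, rfl⟩
    · by_cases hvx : v = x
      · subst hvx
        exact Ideal.subset_span (Or.inr rfl)
      · refine Ideal.subset_span (Or.inl ⟨_, Or.inl ⟨v, ?_, rfl⟩, rfl⟩)
        simpa [hvx] using hv
    · exact Ideal.subset_span (Or.inl ⟨_, Or.inr hs, rfl⟩)
  · apply Ideal.span_le.2
    rintro _ (⟨s, ⟨v, hv, rfl⟩ | hs, rfl⟩ | rfl)
    · exact Ideal.subset_span ⟨_, Or.inl ⟨v, by simp [hv], rfl⟩, rfl⟩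
    · exact Ideal.subset_span ⟨_, Or.inr hs, rfl⟩
    · exact Ideal.subset_span ⟨_, Or.inl ⟨x, by simp, rfl⟩, rfl⟩

theorem Jid_ses (K : Type*) [Field K] (G : SimpleGraph V) (R : Finset V) (x : V) (hx : x ∈ R) :
    ∃ (f : (MvPolynomial V K ⧸ Jid K G (delN G R x)) →ₗ[MvPolynomial V K]
        (MvPolynomial V K ⧸ Jid K G R))
      (g : (MvPolynomial V K ⧸ Jid K G R) →ₗ[MvPolynomial V K]
        (MvPolynomial V K ⧸ Jid K G (R.erase x))),
      Function.Injective f ∧ Function.Surjective g ∧ Function.Exact f g := by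
  let f : (MvPolynomial V K ⧸ Jid K G (delN G R x)) →ₗ[MvPolynomial V K]
        (MvPolynomial V K ⧸ Jid K G R) :=
    Submodule.mapQ (Jid K G (delN G R x)) (Jid K G R) (LinearMap.mulLeft (MvPolynomial V K) (X x))
      (fun p hp => (X_mul_mem_Jid hx).2 hp)
  have hle : Jid K G R ≤ Jid K G (R.erase x) := by
    rw [Jid_erase]; exact le_sup_left
  let g : (MvPolynomial V K ⧸ Jid K G R) →ₗ[MvPolynomial V K]
        (MvPolynomial V K ⧸ Jid K G (R.erase x)) := Submodule.factor hle
  refine ⟨f, g, ?_, Submodule.factor_surjective hle, ?_⟩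
  · rw [injective_iff_map_eq_zero]
    intro p
    induction p using Submodule.Quotient.induction_on with
    | H p =>
      intro h
      rw [Submodule.Quotient.mk_eq_zero]
      have : (Submodule.Quotient.mk (X x * p) : MvPolynomial V K ⧸ Jid K G R) = 0 := h
      rw [Submodule.Quotient.mk_eq_zero] at this
      exact (X_mul_mem_Jid hx).1 this
  · intro p
    induction p using Submodule.Quotient.induction_on with
    | H p =>
      have h0 : g (Submodule.Quotient.mk p) = Submodule.Quotient.mk p := rfl
      rw [h0, Submodule.Quotient.mk_eq_zero, Jid_erase]
      constructor
      · intro h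
        obtain ⟨y, hy, z, hz, rfl⟩ := Submodule.mem_sup.1 h
        obtain ⟨w, rfl⟩ := Ideal.mem_span_singleton.1 hz
        refine ⟨Submodule.Quotient.mk w, ?_⟩
        change Submodule.Quotient.mk (X x * w) = _
        rw [eq_comm, Submodule.Quotient.eq]
        simpa using hy
      · rintro ⟨q, hq⟩
        induction q using Submodule.Quotient.induction_on with
        | H q =>
          change Submodule.Quotient.mk (X x * q) = _ at hq
          rw [eq_comm, Submodule.Quotient.eq] at hq
          have h2 : X x * q ∈ Ideal.span {(X x : MvPolynomial V K)} :=
            Ideal.mem_span_singleton.2 ⟨q, rfl⟩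
          have := Submodule.add_mem_sup hq h2
          simpa using this

theorem pdimLE_leaf (K : Type*) [Field K] (k : ℕ) : ∀ (R : Finset V),
    R.card + k = Fintype.card V → pdimLE (MvPolynomial V K) k
      (MvPolynomial V K ⧸ Jid K (⊥ : SimpleGraph V) R) := by
  induction k with
  | zero =>
    intro R hR
    have hR' : R = Finset.univ := (Finset.card_eq_iff_eq_univ R).1 (by simpa using hR)
    subst hR'
    have : Jid K (⊥ : SimpleGraph V) Finset.univ = ⊥ := by
      rw [← edgeIdeal_eq_Jid]
      simp [edgeIdeal]
    rw [this]
    change Module.Projective _ _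
    exact Module.Projective.of_equiv (Submodule.quotEquivOfEqBot (⊥ : Ideal (MvPolynomial V K)) rfl).symm
  | succ k ih =>
    intro R hR
    obtain ⟨x, hx⟩ : ∃ x, x ∉ R := by
      by_contra h
      push Not at h
      have : R = Finset.univ := Finset.eq_univ_iff_forall.2 h
      subst this
      simp at hR
    obtain ⟨f, g, hf, hg, hfg⟩ := Jid_ses K (⊥ : SimpleGraph V) (insert x R) x
      (Finset.mem_insert_self _ _)
    have h1 : delN (⊥ : SimpleGraph V) (insert x R) x = insert x R := by
      ext v; simp [mem_delN]
    have hc := ih (insert x R) (by rw [Finset.card_insert_of_notMem hx]; omega)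
    have h3 := pdimLE_right f g hf hg hfg (by rw [h1]; exact hc) hc
    rwa [Finset.erase_insert hx] at h3

theorem Win.pdimLE {K : Type*} [Field K] {G : SimpleGraph V} {R : Finset V} {d : ℕ}
    (h : Win G R d) : pdimLE (MvPolynomial V K) (Fintype.card V - d)
      (MvPolynomial V K ⧸ Jid K G R) := by
  induction h with
  | leaf R d h hd =>
    have hR : R.card ≤ Fintype.card V := Finset.card_le_univ R
    have : Jid K G R = Jid K ⊥ R := by
      ext f
      rw [mem_Jid, mem_Jid]
      refine forall₂_congr fun m _ => ?_
      constructor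
      · rintro (h' | ⟨i, j, hij, hi, hj⟩)
        · exact Or.inl h'
        · by_cases h1 : i ∈ R
          · by_cases h2 : j ∈ R
            · exact absurd hij (h i h1 j h2)
            · exact Or.inl ⟨j, h2, hj⟩
          · exact Or.inl ⟨i, h1, hi⟩
      · rintro (h' | ⟨i, j, hij, hi, hj⟩)
        · exact Or.inl h'
        · exact absurd hij (by simp)
    rw [this]
    exact pdimLE_mono (by omega) _ (pdimLE_leaf K (Fintype.card V - R.card) R (by omega))
  | step R d x hx _ _ ih1 ih2 =>
    obtain ⟨f, g, hf, hg, hfg⟩ := Jid_ses K G R x hx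
    exact pdimLE_mid f g hf hg hfg ih2 ih1

end UpperBound

set_option linter.unusedSectionVars false
set_option linter.unusedSimpArgs false

/-! ### Koszul type cochains and lower bounds for the projective dimension -/

section Koszul

variable {V : Type} [Fintype V] [DecidableEq V] {R : Type*} [CommRing R]

/-- the sign in the Koszul differential -/
def sg (R : Type*) [CommRing R] (ρ : V → ℕ) (v : V) (F : Finset V) : R :=
  (-1) ^ (F.filter (fun b => ρ b < ρ v)).card

theorem sg_mul_self (ρ : V → ℕ) (v : V) (F : Finset V) : sg R ρ v F * sg R ρ v F = 1 := by
  unfold sg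
  rw [← pow_add, ← two_mul, pow_mul]; simp

variable {M : Type*} [AddCommGroup M] [Module R M]

/-- the Koszul differential -/
def dk (ρ : V → ℕ) (x : V → R) (c : Finset V → M) (F : Finset V) : M :=
  ∑ v ∈ F, (sg R ρ v F * x v) • c (F.erase v)

variable {ρ : V → ℕ} {x : V → R}

theorem dk_congr {c c' : Finset V → M} {F : Finset V}
    (h : ∀ v ∈ F, c (F.erase v) = c' (F.erase v)) : dk ρ x c F = dk ρ x c' F :=
  Finset.sum_congr rfl fun v hv => by rw [h v hv]

theorem dk_sub (c c' : Finset V → M) (F : Finset V) :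
    dk ρ x (fun H => c H - c' H) F = dk ρ x c F - dk ρ x c' F := by
  simp [dk, smul_sub, Finset.sum_sub_distrib]

theorem dk_smul (a : R) (c : Finset V → M) (F : Finset V) :
    dk ρ x (fun H => a • c H) F = a • dk ρ x c F := by
  simp only [dk, Finset.smul_sum]
  exact Finset.sum_congr rfl fun v _ => smul_comm _ _ _

theorem dk_map {N : Type*} [AddCommGroup N] [Module R N] (f : M →ₗ[R] N) (c : Finset V → M)
    (F : Finset V) : f (dk ρ x c F) = dk ρ x (fun H => f (c H)) F := by
  simp [dk]

theorem dk_insert (c : Finset V → M) {v0 : V} {F : Finset V} (h : ∀ w ∈ F, ρ v0 < ρ w) :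
    dk ρ x c (insert v0 F) = x v0 • c F - dk ρ x (fun H => c (insert v0 H)) F := by
  have hv0 : v0 ∉ F := fun hh => lt_irrefl _ (h _ hh)
  unfold dk
  rw [Finset.sum_insert hv0, sub_eq_add_neg, ← Finset.sum_neg_distrib]
  congr 1
  · rw [Finset.erase_insert hv0]
    have : (insert v0 F).filter (fun b => ρ b < ρ v0) = ∅ := by
      ext b
      simp only [Finset.mem_filter, Finset.mem_insert, Finset.notMem_empty, iff_false, not_and]
      rintro (rfl | hb)
      · simp
      · have := h b hb; omega
    simp [sg, this]
  · refine Finset.sum_congr rfl fun v hv => ?_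
    have hne : v0 ≠ v := by rintro rfl; exact hv0 hv
    rw [Finset.erase_insert_of_ne hne]
    have : (insert v0 F).filter (fun b => ρ b < ρ v) =
        insert v0 (F.filter (fun b => ρ b < ρ v)) := by
      rw [Finset.filter_insert, if_pos (h v hv)]
    simp [sg, this, Finset.card_insert_of_notMem, hv0, pow_succ]

theorem dk_dk (hρ : Function.Injective ρ) (F : Finset V) :
    ∀ c : Finset V → M, dk ρ x (dk ρ x c) F = 0 := by
  induction F using Finset.induction_on_min_value ρ with
  | empty => intro c; simp [dk]
  | insert v0 F hv0 hmin ih =>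
    intro c
    have hm : ∀ w ∈ F, ρ v0 < ρ w := fun w hw =>
      lt_of_le_of_ne (hmin w hw) (fun h => hv0 (by rw [hρ h]; exact hw))
    rw [dk_insert _ hm]
    have : dk ρ x (fun H => dk ρ x c (insert v0 H)) F =
        dk ρ x (fun H => x v0 • c H - dk ρ x (fun H => c (insert v0 H)) H) F :=
      dk_congr fun v _ => dk_insert _ fun w hw => hm w (Finset.mem_of_mem_erase hw)
    rw [this, dk_sub, dk_smul, ih]
    simp

/-- exactness in degree `q` of the Koszul complex on `B` -/
def KExact (ρ : V → ℕ) (x : V → R) (q : ℕ) (B : Finset V) (M : Type*) [AddCommGroup M]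
    [Module R M] : Prop :=
  ∀ c : Finset V → M, (∀ F ⊆ B, F.card = q + 1 → dk ρ x c F = 0) →
    ∃ u : Finset V → M, ∀ F ⊆ B, F.card = q → dk ρ x u F = c F

/-- membership in `(x_B) M` -/
def InB (x : V → R) (B : Finset V) (m : M) : Prop := ∃ r : V → M, m = ∑ w ∈ B, x w • r w

/-- all the `x_v` form regular sequences in any order -/
def RegB (x : V → R) (M : Type*) [AddCommGroup M] [Module R M] : Prop :=
  ∀ (B : Finset V) (v : V) (m : M), v ∉ B → InB x B (x v • m) → InB x B m

theorem KExact_of_RegB (hρ : Function.Injective ρ) (hM : RegB x M) (B : Finset V) :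
    ∀ q, q < B.card → KExact ρ x q B M := by
  induction B using Finset.induction_on_min_value ρ with
  | empty => intro q hq; simp at hq
  | insert v0 B hv0 hmin ih =>
    intro q hq c hc
    have hm : ∀ F ⊆ B, ∀ w ∈ F, ρ v0 < ρ w := fun F hF w hw =>
      lt_of_le_of_ne (hmin w (hF hw)) (fun h => hv0 (by rw [hρ h]; exact (hF hw)))
    rw [Finset.card_insert_of_notMem hv0] at hq
    have hv0F : ∀ F ⊆ B, v0 ∉ F := fun F hF h => hv0 (hF h)
    obtain ⟨y, hy⟩ : ∃ y : Finset V → M, ∀ F ⊆ B, F.card = q → dk ρ x y F = c F := by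
      rcases Nat.lt_succ_iff_lt_or_eq.1 hq with h | h
      · exact ih q h c fun F hF hFc => hc F (hF.trans (Finset.subset_insert _ _)) hFc
      · have h1 := hc (insert v0 B) subset_rfl (by rw [Finset.card_insert_of_notMem hv0, h])
        rw [dk_insert _ (hm B subset_rfl), sub_eq_zero] at h1
        obtain ⟨r, hr⟩ := hM B v0 (c B) hv0 ⟨fun w => sg R ρ w B • c (insert v0 (B.erase w)), by
          rw [h1]; simp [dk, smul_smul, mul_comm]⟩
        refine ⟨fun H => ∑ w ∈ B \ H, sg R ρ w B • r w, fun F hF hFc => ?_⟩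
        obtain rfl : F = B := Finset.eq_of_subset_of_card_le hF (by omega)
        rw [hr]
        refine Finset.sum_congr rfl fun w hw => ?_
        have : F \ F.erase w = {w} := by
          ext b; simp only [Finset.mem_sdiff, Finset.mem_erase, Finset.mem_singleton]
          constructor
          · rintro ⟨h1, h2⟩; by_contra h3; exact h2 ⟨h3, h1⟩
          · rintro rfl; exact ⟨hw, fun h => h.1 rfl⟩
        simp only [this, Finset.sum_singleton, smul_smul]
        rw [mul_right_comm, sg_mul_self, one_mul]
    rcases q with _ | q
    · refine ⟨y, fun F hF hFc => ?_⟩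
      rw [Finset.card_eq_zero] at hFc
      subst hFc
      exact hy ∅ (by simp) (by simp)
    · obtain ⟨w, hw⟩ := ih q (by omega) (fun F => x v0 • y F - c (insert v0 F)) (by
        intro F hF hFc
        rw [dk_sub, dk_smul, hy F hF hFc, ← dk_insert _ (hm F hF)]
        exact hc _ (Finset.insert_subset_insert _ hF)
          (by rw [Finset.card_insert_of_notMem (hv0F F hF), hFc]))
      refine ⟨fun F => if v0 ∈ F then w (F.erase v0) else y F, fun F hF hFc => ?_⟩
      by_cases h0 : v0 ∈ F
      · obtain ⟨F', hF', rfl⟩ : ∃ F', v0 ∉ F' ∧ F = insert v0 F' :=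
          ⟨F.erase v0, by simp, by rw [Finset.insert_erase h0]⟩
        have hsub : F' ⊆ B := by
          intro b hb
          rcases Finset.mem_insert.1 (hF (Finset.mem_insert_of_mem hb)) with rfl | h
          · exact absurd hb hF'
          · exact h
        rw [Finset.card_insert_of_notMem hF'] at hFc
        rw [dk_insert _ (hm F' hsub)]
        have h2 : dk ρ x (fun H => (fun F => if v0 ∈ F then w (F.erase v0) else y F)
            (insert v0 H)) F' = dk ρ x w F' := by
          refine dk_congr fun v hv => ?_
          have : v0 ∉ F'.erase v := fun h => hF' (Finset.mem_of_mem_erase h)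
          simp [Finset.erase_insert this]
        rw [h2, hw F' hsub (by omega), if_neg hF']
        simp
      · have hsub : F ⊆ B := by
          intro b hb
          rcases Finset.mem_insert.1 (hF hb) with rfl | h
          · exact absurd hb h0
          · exact h
        rw [← hy F hsub hFc]
        refine dk_congr fun v hv => ?_
        have : v0 ∉ F.erase v := fun h => h0 (Finset.mem_of_mem_erase h)
        simp [this]

theorem InB_mvPoly {K : Type*} [Field K] {B : Finset V} {p : MvPolynomial V K} :
    InB (X : V → MvPolynomial V K) B p ↔ ∀ m ∈ p.support, ∃ i ∈ B, m i ≠ 0 := by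
  have := mem_ideal_span_X_image (x := p) (s := (B : Set V))
  simp only [Finset.mem_coe] at this
  rw [← this]
  unfold InB
  rw [Ideal.span, Submodule.mem_span_image_finset_iff_exists_fun]
  constructor
  · rintro ⟨r, hr⟩
    refine ⟨fun w => r w, ?_⟩
    rw [hr, ← Finset.sum_coe_sort B]
    exact Finset.sum_congr rfl fun w _ => by simp [mul_comm]
  · rintro ⟨r, hr⟩
    refine ⟨fun w => if h : w ∈ B then r ⟨w, h⟩ else 0, ?_⟩
    rw [← hr, ← Finset.sum_coe_sort B]
    exact Finset.sum_congr rfl fun w _ => by simp [mul_comm]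

theorem RegB_mvPoly {K : Type*} [Field K] :
    RegB (X : V → MvPolynomial V K) (MvPolynomial V K) := by
  intro B v p hv h
  rw [InB_mvPoly] at h ⊢
  rw [smul_eq_mul, support_X_mul] at h
  intro m hm
  obtain ⟨i, hi, hne⟩ := h (Finsupp.single v 1 + m) (by
    simp only [Finset.mem_map, addLeftEmbedding_apply]; exact ⟨m, hm, rfl⟩)
  refine ⟨i, hi, ?_⟩
  have : v ≠ i := by rintro rfl; exact hv hi
  simpa [this] using hne

theorem RegB_finsupp (hR : RegB x R) (ι : Type*) : RegB x (ι →₀ R) := by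
  classical
  rintro B v g hv ⟨r, hr⟩
  have h1 : ∀ i, InB x B (g i) := fun i => hR B v (g i) hv
    ⟨fun w => r w i, by
      have := DFunLike.congr_fun hr i
      simpa [Finsupp.finsetSum_apply] using this⟩
  choose s hs using h1
  refine ⟨fun w => ∑ i ∈ g.support, Finsupp.single i (s i w), ?_⟩
  have h2 : ∀ w ∈ B, x w • ∑ i ∈ g.support, Finsupp.single i (s i w)
      = ∑ i ∈ g.support, Finsupp.single i (x w • s i w) := by
    intro w _
    simp [Finset.smul_sum]
  rw [Finset.sum_congr rfl h2, Finset.sum_comm]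
  conv_lhs => rw [← Finsupp.sum_single g]
  unfold Finsupp.sum
  refine Finset.sum_congr rfl fun i _ => ?_
  conv_lhs => rw [hs i]
  exact map_sum (Finsupp.singleAddHom i) _ _

theorem RegB_projective (hR : RegB x R) [hP : Module.Projective R M] : RegB x M := by
  obtain ⟨s, hs⟩ := hP.out
  intro B v m hv ⟨r, hr⟩
  obtain ⟨r', hr'⟩ := RegB_finsupp hR M B v (s m) hv ⟨fun w => s (r w), by
    rw [← map_smul, hr]; simp⟩
  refine ⟨fun w => Finsupp.linearCombination R id (r' w), ?_⟩
  have := congrArg (Finsupp.linearCombination R (id : M → M)) hr'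
  rw [hs m] at this
  rw [this]; simp

end Koszul

section LowerBound
universe u
variable {V : Type} [Fintype V] [DecidableEq V] {R : Type u} [CommRing R] {ρ : V → ℕ} {x : V → R}

theorem KExact_of_pdimLE (hρ : Function.Injective ρ) (hR : RegB x R) (B : Finset V) (n : ℕ) :
    ∀ (q : ℕ) (M : Type u) [AddCommGroup M] [Module R M], pdimLE R n M → q + n < B.card →
      KExact ρ x q B M := by
  induction n with
  | zero =>
    intro q M _ _ hM hq
    have : Module.Projective R M := hM
    exact KExact_of_RegB hρ (RegB_projective hR) B q (by omega)
  | succ n ih =>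
    intro q M _ _ hM hq c hc
    obtain ⟨P, _, _, f, hP, hf, hk⟩ := hM
    choose s hs using hf
    have hcoc : ∀ F ⊆ B, F.card = q + 1 → dk ρ x (fun H => s (c H)) F ∈ LinearMap.ker f := by
      intro F hF hFc
      rw [LinearMap.mem_ker, dk_map]
      simp only [hs]
      exact hc F hF hFc
    classical
    let e : Finset V → LinearMap.ker f := fun F =>
      if h : dk ρ x (fun H => s (c H)) F ∈ LinearMap.ker f then ⟨_, h⟩ else 0
    have he : ∀ F ⊆ B, F.card = q + 1 → (e F : P) = dk ρ x (fun H => s (c H)) F := by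
      intro F hF hFc
      simp only [e, dif_pos (hcoc F hF hFc)]
    obtain ⟨u, hu⟩ := ih (q + 1) (LinearMap.ker f) hk (by omega) e (by
      intro F hF hFc
      have h1 := dk_map (ρ := ρ) (x := x) (LinearMap.ker f).subtype e F
      have h2 : dk ρ x (fun H => (LinearMap.ker f).subtype (e H)) F =
          dk ρ x (dk ρ x (fun H => s (c H))) F := by
        refine dk_congr fun v hv => ?_
        exact he _ ((Finset.erase_subset _ _).trans hF)
          (by rw [Finset.card_erase_of_mem hv]; omega)
      rw [h2, dk_dk hρ] at h1
      exact Subtype.ext h1)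
    obtain ⟨y, hy⟩ := KExact_of_RegB (M := P) hρ (RegB_projective hR) B q (by omega)
      (fun H => s (c H) - (u H : P)) (by
        intro F hF hFc
        rw [dk_sub, sub_eq_zero, ← he F hF hFc, ← hu F hF hFc]
        exact dk_map (LinearMap.ker f).subtype u F)
    refine ⟨fun H => f (y H), fun F hF hFc => ?_⟩
    rw [← dk_map, hy F hF hFc, map_sub, hs]
    simp

end LowerBound

set_option linter.unusedSectionVars false
set_option linter.unusedSimpArgs false

section LB2
universe u
variable {V : Type} [Fintype V] [DecidableEq V] {K : Type u} [Field K]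

/-- exponent vector of a squarefree monomial -/
noncomputable def eF (F : Finset V) : V →₀ ℕ :=
  Finsupp.equivFunOnFinite.symm (fun v => if v ∈ F then 1 else 0)

theorem eF_apply (F : Finset V) (v : V) : eF F v = if v ∈ F then 1 else 0 := by
  simp [eF]

theorem eF_ne (F : Finset V) (v : V) : eF F v ≠ 0 ↔ v ∈ F := by
  simp [eF_apply]

theorem eF_erase {F : Finset V} {v : V} (hv : v ∈ F) :
    eF F = Finsupp.single v 1 + eF (F.erase v) := by
  ext w
  simp only [Finsupp.coe_add, Pi.add_apply, eF_apply, Finset.mem_erase, Finsupp.single_apply]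
  by_cases h : v = w
  · subst h; simp [hv]
  · have : w ≠ v := fun h' => h h'.symm
    simp [h, this]

/-- independent sets -/
def Indep (G : SimpleGraph V) (F : Finset V) : Prop := ∀ u ∈ F, ∀ v ∈ F, ¬ G.Adj u v

theorem mk_eF_eq_zero {G : SimpleGraph V} {F : Finset V} (h : ¬ Indep G F) :
    (Submodule.Quotient.mk (monomial (eF F) (1 : K)) : MvPolynomial V K ⧸ Jid K G Finset.univ)
      = 0 := by
  rw [Submodule.Quotient.mk_eq_zero, mem_Jid]
  intro m hm
  have := support_monomial_subset hm
  rw [Finset.mem_singleton] at this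
  subst this
  right
  simp only [Indep] at h
  push Not at h
  obtain ⟨i, hi, j, hj, hij⟩ := h
  exact ⟨i, j, hij, (eF_ne _ _).2 hi, (eF_ne _ _).2 hj⟩

theorem coeff_eF_of_mem {G : SimpleGraph V} {F : Finset V} (h : Indep G F)
    {p : MvPolynomial V K} (hp : p ∈ Jid K G Finset.univ) : coeff (eF F) p = 0 := by
  by_contra hne
  rw [mem_Jid] at hp
  rcases hp _ (mem_support_iff.2 hne) with ⟨v, hv, _⟩ | ⟨i, j, hij, hi, hj⟩
  · exact hv (Finset.mem_univ _)
  · exact h i ((eF_ne _ _).1 hi) j ((eF_ne _ _).1 hj) hij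

theorem LB_maxIndep {G : SimpleGraph V} {F0 : Finset V} (h0 : Indep G F0)
    (hmax : ∀ v ∉ F0, ∃ u ∈ F0, G.Adj u v) {n : ℕ} (hn : n + F0.card < Fintype.card V) :
    ¬ pdimLE (MvPolynomial V K) n (MvPolynomial V K ⧸ Jid K G Finset.univ) := by
  intro hp
  obtain ⟨ρ, hρ⟩ : ∃ ρ : V → ℕ, Function.Injective ρ :=
    ⟨fun v => (Fintype.equivFin V v : ℕ), fun a b h =>
      (Fintype.equivFin V).injective (Fin.ext h)⟩
  obtain ⟨u, hu⟩ := KExact_of_pdimLE hρ RegB_mvPoly (F0ᶜ) n 0 _ hp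
    (by rw [Finset.card_compl]; omega)
    (fun _ => (Submodule.Quotient.mk (monomial (eF F0) (1 : K)))) (by
      intro F hF hFc
      obtain ⟨v, rfl⟩ := Finset.card_eq_one.1 hFc
      have hv : v ∉ F0 := by simpa using hF
      obtain ⟨w, hw, hwv⟩ := hmax v hv
      have h2 := mk_eF_eq_zero (K := K) (G := G) (F := insert v F0)
        (fun h => h w (by simp [hw]) v (by simp) hwv)
      rw [eF_erase (Finset.mem_insert_self v F0), Finset.erase_insert hv] at h2
      simp only [dk, Finset.sum_singleton]
      rw [mul_smul, ← Submodule.Quotient.mk_smul]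
      have : (X v : MvPolynomial V K) • monomial (eF F0) (1 : K) =
          monomial (Finsupp.single v 1 + eF F0) 1 := by
        simp [X, monomial_mul]
      rw [this, h2, smul_zero])
  have h1 := hu ∅ (by simp) (by simp)
  simp only [dk, Finset.sum_empty] at h1
  have h2 := (Submodule.Quotient.mk_eq_zero _).1 h1.symm
  have h3 := coeff_eF_of_mem h0 h2
  simp at h3

/-- combinatorial certificate -/
structure Cert (G : SimpleGraph V) (d : ℕ) : Type 1 where
  ρ : V → ℕ
  hρ : Function.Injective ρ
  Fam : Finset V → Prop
  hcard : ∀ F, Fam F → F.card = d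
  coc : ∀ F, Indep G F → ∀ w ∈ F, Fam (F.erase w) → ∃ w' ∈ F, w' ≠ w ∧ Fam (F.erase w') ∧
    (∀ z ∈ F, ¬ (ρ w < ρ z ∧ ρ z < ρ w') ∧ ¬ (ρ w' < ρ z ∧ ρ z < ρ w)) ∧
    ∀ w'' ∈ F, Fam (F.erase w'') → w'' = w ∨ w'' = w'
  ι : Type
  fι : Fintype ι
  hι : Fintype.card ι = d
  ch : ι → Bool → V
  hord : ∀ i j, i ≠ j → (∀ ε ε', ρ (ch i ε) < ρ (ch j ε')) ∨ (∀ ε ε', ρ (ch j ε) < ρ (ch i ε'))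
  hind : ∀ i j, i ≠ j → ∀ ε ε', ¬ G.Adj (ch i ε) (ch j ε')
  hFam : ∀ ε : ι → Bool, Fam (Finset.univ.image (fun i => ch i (ε i))) ↔ ∀ i, ε i = false

theorem sg_adj {R : Type*} [CommRing R] {ρ : V → ℕ} (hρ : Function.Injective ρ)
    {F : Finset V} {w w' : V} (hw : w ∈ F)
    (hlt : ρ w < ρ w') (hb : ∀ z ∈ F, ¬ (ρ w < ρ z ∧ ρ z < ρ w')) :
    sg R ρ w' F = - sg R ρ w F := by
  have : F.filter (fun b => ρ b < ρ w') = insert w (F.filter (fun b => ρ b < ρ w)) := by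
    ext b
    simp only [Finset.mem_filter, Finset.mem_insert]
    constructor
    · rintro ⟨h1, h2⟩
      rcases lt_trichotomy (ρ b) (ρ w) with h | h | h
      · exact Or.inr ⟨h1, h⟩
      · exact Or.inl (hρ h)
      · exact absurd ⟨h, h2⟩ (hb b h1)
    · rintro (rfl | ⟨h1, h2⟩)
      · exact ⟨hw, hlt⟩
      · exact ⟨h1, h2.trans hlt⟩
  unfold sg
  rw [this, Finset.card_insert_of_notMem (by simp), pow_succ]
  simp

theorem Cert.cocycle {G : SimpleGraph V} {d : ℕ} (C : Cert G d) [DecidablePred C.Fam]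
    (F : Finset V) :
    dk C.ρ (X : V → MvPolynomial V K) (fun F => if C.Fam F then
      (Submodule.Quotient.mk (monomial (eF F) (1 : K)) : MvPolynomial V K ⧸ Jid K G Finset.univ)
      else 0) F = 0 := by
  set z : MvPolynomial V K ⧸ Jid K G Finset.univ :=
    Submodule.Quotient.mk (monomial (eF F) (1 : K)) with hz
  have hterm : ∀ v ∈ F, (sg (MvPolynomial V K) C.ρ v F * X v) • (if C.Fam (F.erase v) then
      (Submodule.Quotient.mk (monomial (eF (F.erase v)) (1 : K)) :
        MvPolynomial V K ⧸ Jid K G Finset.univ) else 0) =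
      if C.Fam (F.erase v) then sg (MvPolynomial V K) C.ρ v F • z else 0 := by
    intro v hv
    split_ifs
    · rw [mul_smul, ← Submodule.Quotient.mk_smul, hz, eF_erase hv]
      congr 2
      simp [X, monomial_mul]
    · simp
  unfold dk
  rw [Finset.sum_congr rfl hterm]
  by_cases hF : Indep G F
  · by_cases hw : ∃ w ∈ F, C.Fam (F.erase w)
    · obtain ⟨w, hw, hfw⟩ := hw
      obtain ⟨w', hw', hne, hfw', hbet, huniq⟩ := C.coc F hF w hw hfw
      rw [← Finset.sum_subset (s₁ := {w, w'})]
      · rw [Finset.sum_pair hne.symm, if_pos hfw, if_pos hfw', ← add_smul]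
        rcases lt_or_gt_of_ne (fun h => hne (C.hρ h)) with h | h
        · rw [sg_adj C.hρ hw' h (fun z hz => (hbet z hz).2)]; simp
        · rw [sg_adj C.hρ hw h (fun z hz => (hbet z hz).1)]; simp
      · intro b hb
        rcases Finset.mem_insert.1 hb with rfl | hb
        · exact hw
        · rw [Finset.mem_singleton.1 hb]; exact hw'
      · intro b hb hb'
        rw [if_neg]
        intro hf
        apply hb'
        rcases huniq b hb hf with rfl | rfl <;> simp
    · push Not at hw
      exact Finset.sum_eq_zero fun v hv => if_neg (hw v hv)
  · have : z = 0 := mk_eF_eq_zero hF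
    simp [this]

theorem Cert.LB {G : SimpleGraph V} {d : ℕ} (C : Cert G d) {n : ℕ}
    (hn : n + d < Fintype.card V) :
    ¬ pdimLE (MvPolynomial V K) n (MvPolynomial V K ⧸ Jid K G Finset.univ) := by
  intro hp
  classical
  obtain ⟨u, hu⟩ := KExact_of_pdimLE C.hρ RegB_mvPoly Finset.univ n d _ hp
    (by rw [Finset.card_univ]; omega) _ (fun F _ _ => C.cocycle (K := K) F)
  have hsurj := Submodule.Quotient.mk_surjective (Jid K G Finset.univ)
  choose p hpu using fun H => hsurj (u H)
  have key : ∀ F : Finset V, F.card = d → Indep G F →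
      ∑ v ∈ F, sg K C.ρ v F * coeff (eF (F.erase v)) (p (F.erase v)) =
        if C.Fam F then 1 else 0 := by
    intro F hFc hF
    have h1 := hu F (Finset.subset_univ _) hFc
    have h2 : (Submodule.Quotient.mk (dk C.ρ (X : V → MvPolynomial V K) p F) : MvPolynomial V K ⧸ Jid K G Finset.univ) =
        Submodule.Quotient.mk (if C.Fam F then monomial (eF F) (1 : K) else 0) := by
      have h3 := dk_map (ρ := C.ρ) (x := (X : V → MvPolynomial V K)) (Submodule.mkQ (Jid K G Finset.univ)) p F
      simp only [Submodule.mkQ_apply, hpu] at h3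
      rw [h3, h1]
      split_ifs <;> simp
    rw [Submodule.Quotient.eq] at h2
    have h4 := coeff_eF_of_mem hF h2
    rw [coeff_sub, sub_eq_zero] at h4
    have h5 : coeff (eF F) (if C.Fam F then monomial (eF F) (1 : K) else 0) =
        if C.Fam F then 1 else 0 := by split_ifs <;> simp
    rw [h5] at h4
    rw [← h4, dk, coeff_sum]
    refine Finset.sum_congr rfl fun v hv => ?_
    rw [eF_erase hv]
    have : sg (MvPolynomial V K) C.ρ v F = MvPolynomial.C (sg K C.ρ v F) := by simp [sg]
    rw [this, smul_eq_mul, mul_assoc, coeff_C_mul, coeff_X_mul]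
  letI := C.fι
  have hinj : ∀ ε : C.ι → Bool, Function.Injective (fun i => C.ch i (ε i)) := by
    intro ε i j hij
    by_contra hne
    have h2 : C.ρ (C.ch i (ε i)) = C.ρ (C.ch j (ε j)) := congrArg C.ρ hij
    rcases C.hord i j hne with h | h
    · have := h (ε i) (ε j); omega
    · have := h (ε j) (ε i); omega
  let T : (C.ι → Bool) → Finset V := fun ε => Finset.univ.image (fun i => C.ch i (ε i))
  have hTcard : ∀ ε, (T ε).card = d := by
    intro ε
    rw [Finset.card_image_of_injective _ (hinj ε), Finset.card_univ, C.hι]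
  have hTind : ∀ ε, Indep G (T ε) := by
    intro ε a ha b hb
    simp only [T, Finset.mem_image, Finset.mem_univ, true_and] at ha hb
    obtain ⟨i, rfl⟩ := ha
    obtain ⟨j, rfl⟩ := hb
    by_cases h : i = j
    · subst h; exact G.loopless.irrefl _
    · exact C.hind i j h _ _
  let H : C.ι → (C.ι → Bool) → Finset V := fun i ε =>
    (Finset.univ.erase i).image (fun j => C.ch j (ε j))
  have hTe : ∀ ε i, (T ε).erase (C.ch i (ε i)) = H i ε := by
    intro ε i
    simp only [T, H]
    rw [Finset.image_erase (hinj ε)]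
  let k : C.ι → ℕ := fun i =>
    (Finset.univ.filter (fun j => C.ρ (C.ch j false) < C.ρ (C.ch i false))).card
  have hsg : ∀ ε i, sg K C.ρ (C.ch i (ε i)) (T ε) = (-1) ^ k i := by
    intro ε i
    unfold sg
    simp only [T, k]
    rw [Finset.filter_image, Finset.card_image_of_injective _ (hinj ε)]
    congr 3
    ext j
    by_cases h : j = i
    · subst h; simp
    · rcases C.hord j i h with h | h
      · simp [h]
      · have h1 := h (ε i) (ε j)
        have h2 := h false false
        constructor <;> intro h' <;> omega
  have hmain : ∀ ε, ∑ i, (-1) ^ k i * coeff (eF (H i ε)) (p (H i ε)) =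
      if (∀ i, ε i = false) then (1 : K) else 0 := by
    intro ε
    have h1 := key (T ε) (hTcard ε) (hTind ε)
    have h2 : C.Fam (T ε) ↔ ∀ i, ε i = false := C.hFam ε
    simp only [h2] at h1
    rw [← h1]
    simp only [T]
    rw [Finset.sum_image (fun i _ j _ h => hinj ε h)]
    refine Finset.sum_congr rfl fun i _ => ?_
    have h3 := hsg ε i
    have h4 := hTe ε i
    simp only [T] at h3 h4
    rw [h3, h4]
  let χ : (C.ι → Bool) → K := fun ε => ∏ i, if ε i then -1 else 1
  have hsum : ∑ ε, χ ε * ∑ i, (-1) ^ k i * coeff (eF (H i ε)) (p (H i ε)) = 1 := by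
    simp only [hmain]
    rw [Finset.sum_eq_single (fun _ => false)]
    · simp [χ]
    · intro ε _ hε
      rw [if_neg, mul_zero]
      intro h
      exact hε (funext h)
    · intro h; exact absurd (Finset.mem_univ _) h
  have hzero : ∑ ε, χ ε * ∑ i, (-1) ^ k i * coeff (eF (H i ε)) (p (H i ε)) = 0 := by
    simp only [Finset.mul_sum]
    rw [Finset.sum_comm]
    refine Finset.sum_eq_zero fun i _ => ?_
    refine Finset.sum_involution (fun ε _ => Function.update ε i (!ε i)) ?_ ?_ ?_ ?_
    · intro ε _
      have hH : H i (Function.update ε i (!ε i)) = H i ε := by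
        simp only [H]
        refine Finset.image_congr ?_
        intro j hj
        have : j ≠ i := by simpa using hj
        simp [Function.update_of_ne this]
      have hχ : χ (Function.update ε i (!ε i)) = - χ ε := by
        simp only [χ]
        rw [← Finset.mul_prod_erase _ _ (Finset.mem_univ i),
          ← Finset.mul_prod_erase _ (fun j => if ε j then (-1 : K) else 1) (Finset.mem_univ i)]
        have : ∏ j ∈ Finset.univ.erase i, (if Function.update ε i (!ε i) j then (-1 : K) else 1)
            = ∏ j ∈ Finset.univ.erase i, if ε j then (-1 : K) else 1 := by
          refine Finset.prod_congr rfl fun j hj => ?_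
          have : j ≠ i := by simpa using hj
          simp [Function.update_of_ne this]
        rw [this]
        cases h : ε i <;> simp
      rw [hH, hχ]; ring
    · intro ε _ _ h
      have := congrFun h i
      simp at this
    · intro ε _; simp
    · intro ε _
      simp
  exact one_ne_zero (hsum.symm.trans hzero)

end LB2

set_option linter.unusedSectionVars false
set_option linter.unusedSimpArgs false

/-! ### Winning strategies -/

section WinBasic
variable {V : Type} [DecidableEq V] {G : SimpleGraph V}

theorem Win.mono {R : Finset V} {d d' : ℕ} (h : Win G R d) (hd : d' ≤ d) : Win G R d' := by
  induction h with
  | leaf R d h hd1 => exact Win.leaf R d' h (hd.trans hd1)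
  | step R d x hx _ _ ih1 ih2 => exact Win.step R d' x hx (ih1 hd) (ih2 hd)

theorem delN_subset (R : Finset V) (x : V) : delN G R x ⊆ R := fun _ hv => (mem_delN.1 hv).1

theorem win_zero (R : Finset V) : Win G R 0 := by
  induction R using Finset.strongInduction with
  | H R ih =>
    by_cases h : ∀ u ∈ R, ∀ v ∈ R, ¬ G.Adj u v
    · exact Win.leaf R 0 h (by simp)
    · push Not at h
      obtain ⟨u, hu, v, hv, huv⟩ := h
      refine Win.step R 0 u hu (ih _ (Finset.erase_ssubset hu)) (ih _ ?_)
      refine Finset.ssubset_iff_subset_ne.2 ⟨delN_subset R u, fun h => ?_⟩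
      rw [← h] at hv
      exact (mem_delN.1 hv).2 huv

theorem win_one (R : Finset V) (hR : R.Nonempty) : Win G R 1 := by
  induction R using Finset.strongInduction with
  | H R ih =>
    by_cases h : ∀ u ∈ R, ∀ v ∈ R, ¬ G.Adj u v
    · exact Win.leaf R 1 h (Finset.card_pos.2 hR)
    · push Not at h
      obtain ⟨u, hu, v, hv, huv⟩ := h
      refine Win.step R 1 u hu (ih _ (Finset.erase_ssubset hu) ⟨v, ?_⟩) (ih _ ?_ ⟨u, ?_⟩)
      · exact Finset.mem_erase.2 ⟨huv.ne.symm, hv⟩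
      · refine Finset.ssubset_iff_subset_ne.2 ⟨delN_subset R u, fun h => ?_⟩
        rw [← h] at hv
        exact (mem_delN.1 hv).2 huv
      · exact mem_delN.2 ⟨hu, G.loopless.irrefl _⟩

theorem Win.union {A B : Finset V} {d1 d2 : ℕ} (hA : Win G A d1) (hB : Win G B d2)
    (hdis : Disjoint A B) (hno : ∀ u ∈ A, ∀ v ∈ B, ¬ G.Adj u v) : Win G (A ∪ B) (d1 + d2) := by
  induction hA with
  | leaf A d1 h hd1 =>
    induction hB with
    | leaf B d2 h' hd2 =>
      refine Win.leaf _ _ ?_ (by rw [Finset.card_union_of_disjoint hdis]; omega)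
      intro u hu v hv
      rcases Finset.mem_union.1 hu with hu | hu <;> rcases Finset.mem_union.1 hv with hv | hv
      · exact h u hu v hv
      · exact hno u hu v hv
      · exact fun hh => hno v hv u hu hh.symm
      · exact h' u hu v hv
    | step B d2 x hx _ _ ih1 ih2 =>
      have hxA : x ∉ A := fun h => Finset.disjoint_left.1 hdis h hx
      refine Win.step _ _ x (Finset.mem_union_right _ hx) ?_ ?_
      · have : (A ∪ B).erase x = A ∪ B.erase x := by
          ext v; simp only [Finset.mem_erase, Finset.mem_union]
          constructor
          · rintro ⟨h1, h2 | h2⟩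
            · exact Or.inl h2
            · exact Or.inr ⟨h1, h2⟩
          · rintro (h | h)
            · exact ⟨fun h' => hxA (h' ▸ h), Or.inl h⟩
            · exact ⟨h.1, Or.inr h.2⟩
        rw [this]
        exact ih1 (hdis.mono_right (Finset.erase_subset _ _))
          (fun u hu v hv => hno u hu v (Finset.mem_of_mem_erase hv))
      · have : delN G (A ∪ B) x = A ∪ delN G B x := by
          ext v; simp only [mem_delN, Finset.mem_union]
          constructor
          · rintro ⟨h2 | h2, h1⟩
            · exact Or.inl h2
            · exact Or.inr ⟨h2, h1⟩
          · rintro (h | h)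
            · exact ⟨Or.inl h, fun h' => hno v h x hx h'.symm⟩
            · exact ⟨Or.inr h.1, h.2⟩
        rw [this]
        exact ih2 (hdis.mono_right (delN_subset _ _))
          (fun u hu v hv => hno u hu v (delN_subset _ _ hv))
  | step A d1 x hx _ _ ih1 ih2 =>
    have hxB : x ∉ B := fun h => Finset.disjoint_left.1 hdis hx h
    refine Win.step _ _ x (Finset.mem_union_left _ hx) ?_ ?_
    · have : (A ∪ B).erase x = A.erase x ∪ B := by
        ext v; simp only [Finset.mem_erase, Finset.mem_union]
        constructor
        · rintro ⟨h1, h2 | h2⟩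
          · exact Or.inl ⟨h1, h2⟩
          · exact Or.inr h2
        · rintro (h | h)
          · exact ⟨h.1, Or.inl h.2⟩
          · exact ⟨fun h' => hxB (h' ▸ h), Or.inr h⟩
      rw [this]
      exact ih1 (hdis.mono_left (Finset.erase_subset _ _))
        (fun u hu v hv => hno u (Finset.mem_of_mem_erase hu) v hv)
    · have : delN G (A ∪ B) x = delN G A x ∪ B := by
        ext v; simp only [mem_delN, Finset.mem_union]
        constructor
        · rintro ⟨h2 | h2, h1⟩
          · exact Or.inl ⟨h2, h1⟩
          · exact Or.inr h2
        · rintro (h | h)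
          · exact ⟨Or.inl h.1, h.2⟩
          · exact ⟨Or.inr h, fun h' => hno x hx v h h'⟩
      rw [this]
      exact ih2 (hdis.mono_left (delN_subset _ _))
        (fun u hu v hv => hno u (delN_subset _ _ hu) v hv)

theorem Win.split {R : Finset V} (P : V → Prop) [DecidablePred P] {d1 d2 d : ℕ}
    (hA : Win G (R.filter P) d1) (hB : Win G (R.filter (fun v => ¬ P v)) d2)
    (hno : ∀ u ∈ R, P u → ∀ v ∈ R, ¬ P v → ¬ G.Adj u v) (hd : d ≤ d1 + d2) : Win G R d := by
  have h := Win.union hA hB (Finset.disjoint_filter_filter_not _ _ _) (by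
    intro u hu v hv
    simp only [Finset.mem_filter] at hu hv
    exact hno u hu.1 hu.2 v hv.1 hv.2)
  rw [Finset.filter_union_filter_not_eq] at h
  exact h.mono hd

theorem Win.image {V' : Type} [DecidableEq V'] {G' : SimpleGraph V'} {R : Finset V} {d : ℕ}
    (h : Win G R d) (f : V → V') (hinj : ∀ u ∈ R, ∀ v ∈ R, f u = f v → u = v)
    (hadj : ∀ u ∈ R, ∀ v ∈ R, G'.Adj (f u) (f v) ↔ G.Adj u v) : Win G' (R.image f) d := by
  induction h with
  | leaf R d h hd =>
    refine Win.leaf _ _ ?_ ?_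
    · intro u hu v hv
      obtain ⟨u, hu', rfl⟩ := Finset.mem_image.1 hu
      obtain ⟨v, hv', rfl⟩ := Finset.mem_image.1 hv
      rw [hadj u hu' v hv']; exact h u hu' v hv'
    · rw [Finset.card_image_of_injOn]
      · exact hd
      · intro u hu v hv; exact hinj u hu v hv
  | step R d x hx _ _ ih1 ih2 =>
    refine Win.step _ _ (f x) (Finset.mem_image_of_mem f hx) ?_ ?_
    · have : (R.image f).erase (f x) = (R.erase x).image f := by
        ext v; simp only [Finset.mem_erase, Finset.mem_image]
        constructor
        · rintro ⟨h1, u, hu, rfl⟩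
          exact ⟨u, ⟨fun h => h1 (by rw [h]), hu⟩, rfl⟩
        · rintro ⟨u, ⟨h1, hu⟩, rfl⟩
          exact ⟨fun h => h1 (hinj u hu x hx h), u, hu, rfl⟩
      rw [this]
      exact ih1 (fun u hu v hv => hinj u (Finset.mem_of_mem_erase hu) v (Finset.mem_of_mem_erase hv))
        (fun u hu v hv => hadj u (Finset.mem_of_mem_erase hu) v (Finset.mem_of_mem_erase hv))
    · have : delN G' (R.image f) (f x) = (delN G R x).image f := by
        ext v; simp only [mem_delN, Finset.mem_image]
        constructor
        · rintro ⟨⟨u, hu, rfl⟩, h1⟩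
          exact ⟨u, ⟨hu, fun h => h1 ((hadj x hx u hu).2 h)⟩, rfl⟩
        · rintro ⟨u, ⟨hu, h1⟩, rfl⟩
          exact ⟨⟨u, hu, rfl⟩, fun h => h1 ((hadj x hx u hu).1 h)⟩
      rw [this]
      exact ih2 (fun u hu v hv => hinj u (delN_subset _ _ hu) v (delN_subset _ _ hv))
        (fun u hu v hv => hadj u (delN_subset _ _ hu) v (delN_subset _ _ hv))

end WinBasic

section Strip

/-- the infinite ladder -/
def Lam : SimpleGraph (ℕ × Bool) where
  Adj p q := (p.1 = q.1 ∧ p.2 = !q.2) ∨ (p.2 = q.2 ∧ (p.1 + 1 = q.1 ∨ q.1 + 1 = p.1))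
  symm := ⟨by
    rintro ⟨p, ε⟩ ⟨q, δ⟩ h
    cases ε <;> cases δ <;> simp_all <;> omega⟩
  loopless := ⟨by
    rintro ⟨p, ε⟩ h
    simp at h⟩

theorem Lam_adj (p q : ℕ) (ε δ : Bool) : Lam.Adj (p, ε) (q, δ) ↔
    (p = q ∧ ε = !δ) ∨ (ε = δ ∧ (p + 1 = q ∨ q + 1 = p)) := Iff.rfl

/-- a strip starting with a pendant vertex followed by `n` full rungs -/
structure St (R : Finset (ℕ × Bool)) (i : ℕ) (ε : Bool) (n : ℕ) : Prop where
  h1 : (i, ε) ∈ R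
  h2 : (i, !ε) ∉ R
  h3 : ∀ p δ, (p, δ) ∈ R → i ≤ p
  h4 : ∀ j δ, i < j → j ≤ i + n → (j, δ) ∈ R

theorem two_le_card {α : Type} [DecidableEq α] {s : Finset α} (a b : α) (ha : a ∈ s) (hb : b ∈ s)
    (hab : a ≠ b) : 2 ≤ s.card := by
  rw [← Finset.card_pair hab]
  apply Finset.card_le_card
  intro x hx
  rcases Finset.mem_insert.1 hx with rfl | hx
  · exact ha
  · rw [Finset.mem_singleton.1 hx]; exact hb

theorem bcase (δ ε : Bool) : δ = ε ∨ δ = !ε := by cases δ <;> cases ε <;> simp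

theorem leaf2 {R : Finset (ℕ × Bool)} {a b : ℕ × Bool} (h : ∀ v ∈ R, v = a ∨ v = b)
    (ha : a ∈ R) (hb : b ∈ R) (hab : a ≠ b) (hadj : ¬ Lam.Adj a b) : Win Lam R 2 := by
  refine Win.leaf _ _ ?_ (two_le_card a b ha hb hab)
  intro u hu v hv huv
  rcases h u hu with rfl | rfl <;> rcases h v hv with rfl | rfl
  · exact Lam.loopless.irrefl _ huv
  · exact hadj huv
  · exact hadj huv.symm
  · exact Lam.loopless.irrefl _ huv

/-- moves common to both analyses -/
theorem strip_step {R : Finset (ℕ × Bool)} {i n D : ℕ} {ε : Bool} (h : St R i ε (n + 2))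
    (hN : ∀ R', St R' (i + 2) ε n → (∀ p δ, (p, δ) ∈ R' → (p, δ) ∈ R) → ∃ D', Win Lam R' D' ∧ D ≤ 2 + D')
    (hE : ∀ R', St R' (i + 2) (!ε) n → (∀ p δ, i + 2 < p → ((p, δ) ∈ R' ↔ (p, δ) ∈ R)) →
      ∃ D', Win Lam R' D' ∧ D ≤ 1 + D')
    (hY : ∀ R', (∀ k, n = k + 1 → St R' (i + 3) (!ε) k) → ∃ D', Win Lam R' D' ∧ D ≤ 2 + D') :
    Win Lam R D := by
  obtain ⟨h1, h2, h3, h4⟩ := h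
  have y1 := h4 (i + 1) ε (by omega) (by omega)
  have x1 := h4 (i + 1) (!ε) (by omega) (by omega)
  have y2 := h4 (i + 2) ε (by omega) (by omega)
  have x2 := h4 (i + 2) (!ε) (by omega) (by omega)
  refine Win.step _ _ (i + 1, !ε) x1 ?_ ?_
  · refine Win.step _ _ (i + 2, ε) (Finset.mem_erase.2 ⟨by simp, y2⟩) ?_ ?_
    · obtain ⟨D', hD, hle⟩ := hE
        ((((R.erase (i + 1, !ε)).erase (i + 2, ε))).filter (fun v => ¬ v.1 < i + 2)) (by
          refine ⟨?_, ?_, ?_, ?_⟩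
          · simp [x2]
          · simp
          · simp
          · intro j δ hj hj'
            have := h4 j δ (by omega) (by omega)
            simp [this]; omega) (by
          intro p δ hp
          simp only [Finset.mem_filter, Finset.mem_erase, ne_eq, Prod.mk.injEq]
          constructor
          · rintro ⟨⟨_, _, h⟩, _⟩; exact h
          · intro h
            exact ⟨⟨fun h => by have := h.1; omega, fun h => by have := h.1; omega, h⟩, by omega⟩)
      refine Win.split (fun v => v.1 < i + 2) (d1 := 1) (win_one _ ⟨(i, ε), by simp [h1]⟩) hD ?_ hle
      rintro ⟨p, δ⟩ hp hp1 ⟨q, δ'⟩ hq hq1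
      simp only [Finset.mem_erase, Prod.mk.injEq, ne_eq] at hp hq
      rw [Lam_adj]
      simp only at hp1 hq1
      rintro (h | ⟨rfl, h | h⟩)
      · omega
      · obtain rfl : p = i + 1 := by omega
        obtain rfl : q = i + 2 := by omega
        rcases bcase δ ε with rfl | rfl
        · exact hq.1 ⟨rfl, rfl⟩
        · exact hp.2.1 ⟨rfl, rfl⟩
      · omega
    · obtain ⟨D', hD, hle⟩ := hY
        ((delN Lam (R.erase (i + 1, !ε)) (i + 2, ε)).filter (fun v => ¬ v.1 < i + 3)) (by
          rintro k rfl
          refine ⟨?_, ?_, ?_, ?_⟩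
          · have := h4 (i + 3) (!ε) (by omega) (by omega)
            simp [mem_delN, Lam_adj, this]
          · simp [mem_delN, Lam_adj]
          · simp
          · intro j δ hj hj'
            have := h4 j δ (by omega) (by omega)
            simp [mem_delN, Lam_adj, this]; omega)
      have hcl : ∀ p δ, (p, δ) ∈ delN Lam (R.erase (i + 1, !ε)) (i + 2, ε) → p < i + 3 →
          (p, δ) = (i, ε) ∨ (p, δ) = (i + 2, ε) := by
        intro p δ hp hlt
        simp only [mem_delN, Finset.mem_erase, Lam_adj] at hp
        have := h3 p δ hp.1.2
        obtain rfl | rfl | rfl : p = i ∨ p = i + 1 ∨ p = i + 2 := by omega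
        all_goals rcases bcase δ ε with rfl | rfl
        · exact Or.inl rfl
        · exact absurd hp.1.2 h2
        · exact absurd (Or.inr ⟨rfl, Or.inr rfl⟩) hp.2
        · exact absurd rfl hp.1.1
        · exact Or.inr rfl
        · exact absurd (Or.inl ⟨rfl, by simp⟩) hp.2
      refine Win.split (fun v => v.1 < i + 3) (d1 := 2) (Win.leaf _ _ ?_ ?_) hD ?_ hle
      · rintro ⟨p, δ⟩ hp ⟨q, δ'⟩ hq
        simp only [Finset.mem_filter] at hp hq
        rcases hcl p δ hp.1 hp.2 with h | h <;> rcases hcl q δ' hq.1 hq.2 with h' | h' <;>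
          rw [h, h', Lam_adj] <;> simp <;> omega
      · exact two_le_card (i, ε) (i + 2, ε) (by simp [mem_delN, Lam_adj, h1]; omega)
          (by simp [mem_delN, Lam_adj, y2]) (by simp)
      · rintro ⟨p, δ⟩ hp hp1 ⟨q, δ'⟩ hq hq1 hadj
        simp only at hp1 hq1
        simp only [mem_delN, Finset.mem_erase, Lam_adj] at hq
        rw [Lam_adj] at hadj
        rcases hcl p δ hp hp1 with h | h
        · simp only [Prod.mk.injEq] at h
          omega
        · simp only [Prod.mk.injEq] at h
          obtain ⟨rfl, rfl⟩ := h
          rcases hadj with h | ⟨rfl, h | h⟩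
          · omega
          · exact hq.2 (Or.inr ⟨rfl, by omega⟩)
          · omega
  · obtain ⟨D', hD, hle⟩ := hN ((delN Lam R (i + 1, !ε)).filter (fun v => ¬ v.1 < i + 2)) (by
          refine ⟨?_, ?_, ?_, ?_⟩
          · simp [mem_delN, Lam_adj, y2]
          · simp [mem_delN, Lam_adj]
          · simp
          · intro j δ hj hj'
            have := h4 j δ (by omega) (by omega)
            simp [mem_delN, Lam_adj, this]; omega) (by
          intro p δ hp
          simp only [Finset.mem_filter, mem_delN] at hp
          exact hp.1.1)
    have hcl : ∀ p δ, (p, δ) ∈ delN Lam R (i + 1, !ε) → p < i + 2 →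
          (p, δ) = (i, ε) ∨ (p, δ) = (i + 1, !ε) := by
        intro p δ hp hlt
        simp only [mem_delN, Lam_adj] at hp
        have := h3 p δ hp.1
        obtain rfl | rfl : p = i ∨ p = i + 1 := by omega
        all_goals rcases bcase δ ε with rfl | rfl
        · exact Or.inl rfl
        · exact absurd hp.1 h2
        · exact absurd (Or.inl ⟨rfl, rfl⟩) hp.2
        · exact Or.inr rfl
    refine Win.split (fun v => v.1 < i + 2) (d1 := 2) (Win.leaf _ _ ?_ ?_) hD ?_ hle
    · rintro ⟨p, δ⟩ hp ⟨q, δ'⟩ hq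
      simp only [Finset.mem_filter] at hp hq
      rcases hcl p δ hp.1 hp.2 with h | h <;> rcases hcl q δ' hq.1 hq.2 with h' | h' <;>
        rw [h, h', Lam_adj] <;> simp
    · exact two_le_card (i, ε) (i + 1, !ε) (by simp [mem_delN, Lam_adj, h1])
          (by simp [mem_delN, Lam_adj, x1]) (by simp)
    · rintro ⟨p, δ⟩ hp hp1 ⟨q, δ'⟩ hq hq1 hadj
      simp only at hp1 hq1
      simp only [mem_delN, Lam_adj] at hq
      rw [Lam_adj] at hadj
      rcases hcl p δ hp hp1 with h | h
      · simp only [Prod.mk.injEq] at h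
        omega
      · simp only [Prod.mk.injEq] at h
        obtain ⟨rfl, rfl⟩ := h
        rcases hadj with h | ⟨rfl, h | h⟩
        · omega
        · exact hq.2 (Or.inr ⟨rfl, by omega⟩)
        · omega

theorem winG (n : ℕ) : ∀ (R : Finset (ℕ × Bool)) (i : ℕ) (ε : Bool), St R i ε n →
    Win Lam R (n / 2 + 1) := by
  induction n using Nat.strong_induction_on with
  | _ n ih =>
    intro R i ε h
    by_cases hn : n < 2
    · have : n / 2 + 1 = 1 := by omega
      rw [this]
      exact win_one R ⟨_, h.h1⟩
    · obtain ⟨n, rfl⟩ : ∃ k, n = k + 2 := ⟨n - 2, by omega⟩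
      refine strip_step h ?_ ?_ ?_
      · intro R' hR' _
        exact ⟨_, ih n (by omega) R' _ _ hR', by omega⟩
      · intro R' hR' _
        exact ⟨_, ih n (by omega) R' _ _ hR', by omega⟩
      · intro R' hR'
        rcases n with _ | k
        · exact ⟨0, win_zero _, by omega⟩
        · exact ⟨_, ih k (by omega) R' _ _ (hR' k rfl), by omega⟩

theorem winO (k : ℕ) : ∀ (R : Finset (ℕ × Bool)) (i : ℕ) (ε : Bool), St R i ε (2 * k + 1) →
    (∀ p δ, (p, δ) ∈ R → p ≤ i + 2 * k + 2) →
    (∀ δ, (i + 2 * k + 2, δ) ∈ R ↔ (δ = if k % 2 = 0 then !ε else ε)) →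
    Win Lam R (k + 2) := by
  induction k with
  | zero =>
    intro R i ε ⟨h1, h2, h3, h4⟩ h5 h6
    have y1 := h4 (i + 1) ε (by omega) (by omega)
    have x1 := h4 (i + 1) (!ε) (by omega) (by omega)
    have hx2 := (h6 (!ε)).2 (by simp)
    have hy2 : (i + 2, ε) ∉ R := fun h => by simpa using (h6 ε).1 h
    simp only [mul_zero, add_zero] at hx2
    have hcl : ∀ p δ, (p, δ) ∈ R → (p, δ) = (i, ε) ∨ (p, δ) = (i + 1, ε) ∨ (p, δ) = (i + 1, !ε) ∨
        (p, δ) = (i + 2, !ε) := by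
      intro p δ hp
      have := h3 p δ hp
      have := h5 p δ hp
      obtain rfl | rfl | rfl : p = i ∨ p = i + 1 ∨ p = i + 2 := by omega
      all_goals rcases bcase δ ε with rfl | rfl
      · exact Or.inl rfl
      · exact absurd hp h2
      · exact Or.inr (Or.inl rfl)
      · exact Or.inr (Or.inr (Or.inl rfl))
      · exact absurd hp hy2
      · exact Or.inr (Or.inr (Or.inr rfl))
    refine Win.step _ _ (i + 1, ε) y1 (Win.step _ _ (i + 1, !ε) (by simp [x1]) ?_ ?_) ?_
    · refine leaf2 (a := (i, ε)) (b := (i + 2, !ε)) ?_ (by simp [h1]) (by simp [hx2]) (by simp)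
        (by simp [Lam_adj])
      rintro ⟨p, δ⟩ hp
      simp only [Finset.mem_erase] at hp
      rcases hcl p δ hp.2.2 with h | h | h | h
      · exact Or.inl h
      · exact absurd h hp.2.1
      · exact absurd h hp.1
      · exact Or.inr h
    · refine leaf2 (a := (i, ε)) (b := (i + 1, !ε)) ?_ (by simp [h1, mem_delN, Lam_adj])
        (by simp [x1, mem_delN, Lam_adj]) (by simp) (by simp [Lam_adj])
      rintro ⟨p, δ⟩ hp
      simp only [mem_delN, Finset.mem_erase] at hp
      rcases hcl p δ hp.1.2 with h | h | h | h
      · exact Or.inl h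
      · exact absurd h hp.1.1
      · exact Or.inr h
      · rw [h] at hp; exact absurd (Or.inr ⟨rfl, Or.inl rfl⟩) hp.2
    · refine leaf2 (a := (i + 1, ε)) (b := (i + 2, !ε)) ?_ (by simp [y1, mem_delN, Lam_adj])
        (by simp [hx2, mem_delN, Lam_adj]) (by simp) (by simp [Lam_adj])
      rintro ⟨p, δ⟩ hp
      simp only [mem_delN] at hp
      rcases hcl p δ hp.1 with h | h | h | h
      · rw [h] at hp; exact absurd (Or.inr ⟨rfl, Or.inr rfl⟩) hp.2
      · exact Or.inl h
      · rw [h] at hp; exact absurd (Or.inl ⟨rfl, by simp⟩) hp.2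
      · exact Or.inr h
  | succ k ih =>
    intro R i ε h h5 h6
    have h' : St R i ε ((2 * k + 1) + 2) := h
    refine strip_step h' ?_ ?_ ?_
    · intro R' hR' _
      exact ⟨_, winG _ R' _ _ hR', by omega⟩
    · intro R' hR' hiff
      refine ⟨_, ih R' _ _ hR' ?_ ?_, by omega⟩
      · intro p δ hp
        by_cases hlt : i + 2 < p
        · have := h5 p δ ((hiff p δ hlt).1 hp); omega
        · omega
      · intro δ
        rw [hiff _ _ (by omega)]
        have := h6 δ
        rw [show i + 2 * (k + 1) + 2 = i + 2 + 2 * k + 2 by ring] at this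
        rw [this]
        rcases Nat.mod_two_eq_zero_or_one k with hk | hk
        · rw [if_pos hk, if_neg (by omega)]; simp
        · rw [if_pos (show (k + 1) % 2 = 0 by omega), if_neg (show ¬ k % 2 = 0 by omega)]
    · intro R' hR'
      exact ⟨_, winG (2 * k) R' _ _ (hR' (2 * k) rfl), by omega⟩

end Strip

set_option linter.unusedSectionVars false
set_option linter.unusedSimpArgs false

section Cyc

/-- oriented adjacency of the (possibly twisted) cyclic ladder -/
def lrel (m : ℕ) (τ : Bool) (p q : ℕ × Bool) : Prop :=
  (p.1 = q.1 ∧ p.2 = !q.2) ∨ (p.2 = q.2 ∧ p.1 + 1 = q.1) ∨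
    (p.1 + 1 = m ∧ q.1 = 0 ∧ q.2 = xor p.2 τ)

/-- the cyclic ladder with `m` rungs and twist `τ` -/
def Lad (m : ℕ) (τ : Bool) : SimpleGraph (Fin m × Bool) :=
  SimpleGraph.fromRel (fun p q => lrel m τ ((p.1 : ℕ), p.2) ((q.1 : ℕ), q.2))

theorem Lad_adj {m : ℕ} {τ : Bool} (hm : 2 ≤ m) (i j : Fin m) (ε δ : Bool) :
    (Lad m τ).Adj (i, ε) (j, δ) ↔
      lrel m τ ((i : ℕ), ε) ((j : ℕ), δ) ∨ lrel m τ ((j : ℕ), δ) ((i : ℕ), ε) := by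
  unfold Lad
  rw [SimpleGraph.fromRel_adj]
  simp only [and_iff_right_iff_imp]
  intro h h'
  simp only [Prod.mk.injEq] at h'
  obtain ⟨rfl, rfl⟩ := h'
  simp [lrel] at h
  omega

theorem win_of_strip {m : ℕ} {τ : Bool} (hm : 3 ≤ m) {R : Finset (Fin m × Bool)}
    {S : Finset (ℕ × Bool)} {d : ℕ} (hW : Win Lam S d)
    (hS : ∀ p δ, (p, δ) ∈ S → 1 ≤ p ∧ p ≤ m ∧ (p = m → δ = !τ))
    (hS1 : (m, !τ) ∈ S → (1, true) ∉ S)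
    (h0 : ∀ δ, ((⟨0, by omega⟩ : Fin m), δ) ∈ R ↔ δ = true ∧ (m, !τ) ∈ S)
    (h1 : ∀ k (hk : k < m) δ, 1 ≤ k → (((⟨k, hk⟩ : Fin m), δ) ∈ R ↔ (k, δ) ∈ S)) :
    Win (Lad m τ) R d := by
  let f : ℕ × Bool → Fin m × Bool := fun p =>
    if h : p.1 < m then (⟨p.1, h⟩, p.2) else (⟨0, by omega⟩, true)
  have fa : ∀ p (hp : p < m) δ, f (p, δ) = (⟨p, hp⟩, δ) := by
    intro p hp δ; simp [f, hp]
  have fb : ∀ δ, f (m, δ) = (⟨0, by omega⟩, true) := by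
    intro δ; simp [f]
  have hR : R = S.image f := by
    ext ⟨⟨k, hk⟩, δ⟩
    rw [Finset.mem_image]
    rcases Nat.eq_zero_or_pos k with rfl | hk0
    · rw [h0]
      constructor
      · rintro ⟨rfl, h⟩
        exact ⟨_, h, fb _⟩
      · rintro ⟨⟨p, ε⟩, hp, hf⟩
        obtain ⟨hp1, hp2, hp3⟩ := hS p ε hp
        rcases Nat.lt_or_ge p m with h | h
        · rw [fa p h] at hf
          simp only [Prod.mk.injEq, Fin.mk.injEq] at hf
          omega
        · obtain rfl : p = m := by omega
          rw [fb] at hf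
          simp only [Prod.mk.injEq, Fin.mk.injEq] at hf
          rw [hp3 rfl] at hp
          exact ⟨hf.2.symm, hp⟩
    · rw [h1 k hk δ hk0]
      constructor
      · intro h
        exact ⟨_, h, fa k hk δ⟩
      · rintro ⟨⟨p, ε⟩, hp, hf⟩
        obtain ⟨hp1, hp2, hp3⟩ := hS p ε hp
        rcases Nat.lt_or_ge p m with h | h
        · rw [fa p h] at hf
          simp only [Prod.mk.injEq, Fin.mk.injEq] at hf
          obtain ⟨rfl, rfl⟩ := hf
          exact hp
        · obtain rfl : p = m := by omega
          rw [fb] at hf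
          simp only [Prod.mk.injEq, Fin.mk.injEq] at hf
          omega
  rw [hR]
  refine hW.image f ?_ ?_
  · rintro ⟨p, ε⟩ hp ⟨q, δ⟩ hq hf
    obtain ⟨hp1, hp2, hp3⟩ := hS p ε hp
    obtain ⟨hq1, hq2, hq3⟩ := hS q δ hq
    rcases Nat.lt_or_ge p m with h | h <;> rcases Nat.lt_or_ge q m with h' | h'
    · rw [fa p h, fa q h'] at hf
      simpa using hf
    · obtain rfl : q = m := by omega
      rw [fa p h, fb] at hf
      simp only [Prod.mk.injEq, Fin.mk.injEq] at hf
      omega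
    · obtain rfl : p = m := by omega
      rw [fa q h', fb] at hf
      simp only [Prod.mk.injEq, Fin.mk.injEq] at hf
      omega
    · obtain rfl : p = m := by omega
      obtain rfl : q = p := by omega
      rw [hp3 rfl, hq3 rfl]
  · rintro ⟨p, ε⟩ hp ⟨q, δ⟩ hq
    obtain ⟨hp1, hp2, hp3⟩ := hS p ε hp
    obtain ⟨hq1, hq2, hq3⟩ := hS q δ hq
    rcases Nat.lt_or_ge p m with h | h <;> rcases Nat.lt_or_ge q m with h' | h'
    · rw [fa p h, fa q h', Lad_adj (by omega), Lam_adj]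
      simp only [lrel]
      constructor
      · rintro ((⟨h1, rfl⟩ | ⟨rfl, h1⟩ | ⟨_, h1, _⟩) | (⟨h1, rfl⟩ | ⟨rfl, h1⟩ | ⟨_, h1, _⟩))
        · exact Or.inl ⟨h1, rfl⟩
        · exact Or.inr ⟨rfl, Or.inl h1⟩
        · omega
        · exact Or.inl ⟨h1.symm, by simp⟩
        · exact Or.inr ⟨rfl, Or.inr h1⟩
        · omega
      · rintro (⟨h1, rfl⟩ | ⟨rfl, h1 | h1⟩)
        · exact Or.inl (Or.inl ⟨h1, rfl⟩)
        · exact Or.inl (Or.inr (Or.inl ⟨rfl, h1⟩))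
        · exact Or.inr (Or.inr (Or.inl ⟨rfl, h1⟩))
    · obtain rfl : q = m := by omega
      obtain rfl := hq3 rfl
      rw [fa p h, fb, Lad_adj (by omega), Lam_adj]
      simp only [lrel]
      constructor
      · rintro ((⟨h1, _⟩ | ⟨_, h1⟩ | ⟨h1, _, h2⟩) | (⟨h1, _⟩ | ⟨h2, h1⟩ | ⟨h1, _, _⟩))
        · omega
        · omega
        · refine Or.inr ⟨?_, Or.inl h1⟩
          exact (show ∀ a b : Bool, true = xor a b → a = !b by decide) _ _ h2
        · omega
        · exfalso
          obtain rfl : p = 1 := by omega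
          rw [← h2] at hp
          exact hS1 hq hp
        · omega
      · rintro (⟨h1, _⟩ | ⟨rfl, h1 | h1⟩)
        · omega
        · refine Or.inl (Or.inr (Or.inr ⟨h1, trivial, ?_⟩))
          cases τ <;> simp
        · omega
    · obtain rfl : p = m := by omega
      obtain rfl := hp3 rfl
      rw [fa q h', fb, Lad_adj (by omega), Lam_adj]
      simp only [lrel]
      constructor
      · rintro ((⟨h1, _⟩ | ⟨h2, h1⟩ | ⟨h1, _, h2⟩) | (⟨h1, _⟩ | ⟨_, h1⟩ | ⟨h1, _, h2⟩))
        · omega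
        · exfalso
          obtain rfl : q = 1 := by omega
          rw [← h2] at hq
          exact hS1 hp hq
        · omega
        · omega
        · omega
        · refine Or.inr ⟨?_, Or.inr h1⟩
          exact (show ∀ a b : Bool, true = xor a b → (!b) = a by decide) _ _ h2
      · rintro (⟨h1, _⟩ | ⟨rfl, h1 | h1⟩)
        · omega
        · omega
        · refine Or.inr (Or.inr (Or.inr ⟨h1, trivial, ?_⟩))
          cases τ <;> simp
    · obtain rfl : p = m := by omega
      obtain rfl : q = p := by omega
      rw [hp3 rfl, hq3 rfl]
      simp

theorem win_Lad {m : ℕ} {τ : Bool} (hm : 3 ≤ m) {d : ℕ} (hd : d ≤ (m + 1) / 2)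
    (hE : ∀ S : Finset (ℕ × Bool), St S 1 false (m - 2) → (∀ p δ, (p, δ) ∈ S → p ≤ m) →
      (∀ δ, (m, δ) ∈ S ↔ δ = !τ) → Win Lam S d) :
    Win (Lad m τ) Finset.univ d := by
  have hm2 : 2 ≤ m := by omega
  refine Win.step _ _ (⟨0, by omega⟩, false) (Finset.mem_univ _)
    (Win.step _ _ (⟨1, by omega⟩, true) (by simp) ?_ ?_) ?_
  · let S : Finset (ℕ × Bool) := ((Finset.range (m + 1)) ×ˢ Finset.univ).filter (fun p =>
      1 ≤ p.1 ∧ (p.1 = 1 → p.2 = false) ∧ (p.1 = m → p.2 = !τ))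
    have mS : ∀ p δ, (p, δ) ∈ S ↔ (1 ≤ p ∧ p ≤ m ∧ (p = 1 → δ = false) ∧ (p = m → δ = !τ)) := by
      intro p δ
      simp only [S, Finset.mem_filter, Finset.mem_product, Finset.mem_range, Finset.mem_univ, Nat.lt_succ_iff]
      tauto
    have hS := hE S ⟨(mS _ _).2 ⟨le_rfl, by omega, by simp, by omega⟩, by rw [mS]; simp, by
        intro p δ h; exact ((mS _ _).1 h).1, by
        intro j δ h1 h2
        exact (mS _ _).2 ⟨by omega, by omega, by omega, by omega⟩⟩ (fun p δ h => ((mS _ _).1 h).2.1)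
      (by intro δ; rw [mS]; constructor
          · intro h; exact h.2.2.2 rfl
          · intro h; exact ⟨by omega, by omega, by omega, fun _ => h⟩)
    refine win_of_strip hm hS ?_ ?_ ?_ ?_
    · intro p δ h; have := (mS _ _).1 h; exact ⟨this.1, this.2.1, this.2.2.2⟩
    · intro _ h; simpa using ((mS _ _).1 h).2.2.1 rfl
    · intro δ
      rw [mS]
      simp
      cases δ <;> simp; omega
    · intro k hk δ hk1
      rw [mS]
      simp only [Finset.mem_erase, Finset.mem_univ, and_true, ne_eq, Prod.mk.injEq, Fin.mk.injEq]
      cases δ <;> simp <;> omega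
  · have hN : ∀ (k) (hk : k < m) δ, ((⟨k, hk⟩, δ) : Fin m × Bool) ∈
        delN (Lad m τ) (Finset.univ.erase (⟨0, by omega⟩, false)) (⟨1, by omega⟩, true) ↔
        ((k = 1 ∧ δ = true) ∨ (k = 2 ∧ δ = false) ∨ 3 ≤ k) := by
      intro k hk δ
      rw [mem_delN, Lad_adj hm2]
      simp only [lrel, Finset.mem_erase, Finset.mem_univ, and_true, ne_eq, Prod.mk.injEq,
        Fin.mk.injEq]
      cases δ <;> simp <;> omega
    let S : Finset (ℕ × Bool) := ((Finset.range m) ×ˢ Finset.univ).filter (fun p =>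
      2 ≤ p.1 ∧ (p.1 = 2 → p.2 = false))
    have mS : ∀ p δ, (p, δ) ∈ S ↔ (2 ≤ p ∧ p < m ∧ (p = 2 → δ = false)) := by
      intro p δ
      simp only [S, Finset.mem_filter, Finset.mem_product, Finset.mem_range, Finset.mem_univ]
      tauto
    have hS := winG (m - 3) S 2 false ⟨(mS _ _).2 ⟨le_rfl, by omega, by simp⟩, by rw [mS]; simp, by
        intro p δ h; exact ((mS _ _).1 h).1, by
        intro j δ h1 h2
        exact (mS _ _).2 ⟨by omega, by omega, by omega⟩⟩
    refine Win.split (fun v => (v.1 : ℕ) ≤ 1) (d1 := 1) (win_one _ ⟨(⟨1, by omega⟩, true), ?_⟩)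
      (win_of_strip hm hS ?_ ?_ ?_ ?_) ?_ (by omega)
    · rw [Finset.mem_filter, hN]; simp
    · intro p δ h; have := (mS _ _).1 h; exact ⟨by omega, by omega, by omega⟩
    · intro h; have := (mS _ _).1 h; omega
    · intro δ
      rw [Finset.mem_filter, hN, mS]
      simp
    · intro k hk δ hk1
      rw [Finset.mem_filter, hN, mS]
      cases δ <;> simp <;> omega
    · rintro ⟨⟨p, hp⟩, ε⟩ hu hu1 ⟨⟨q, hq⟩, δ⟩ hv hv1
      have hu2 := (hN _ _ _).1 hu
      simp only at hu1
      obtain ⟨rfl, rfl⟩ : p = 1 ∧ ε = true := by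
        rcases hu2 with h | h | h
        · exact h
        · omega
        · omega
      exact (mem_delN.1 hv).2
  · have hN : ∀ (k) (hk : k < m) δ, ((⟨k, hk⟩, δ) : Fin m × Bool) ∈
        delN (Lad m τ) Finset.univ (⟨0, by omega⟩, false) ↔
        ((k = 0 ∧ δ = false) ∨ (1 ≤ k ∧ (k = 1 → δ = true) ∧ (k + 1 = m → δ = !τ))) := by
      intro k hk δ
      rw [mem_delN, Lad_adj hm2]
      simp only [lrel, Finset.mem_univ]
      cases δ <;> cases τ <;> simp <;> omega
    let S : Finset (ℕ × Bool) := ((Finset.range m) ×ˢ Finset.univ).filter (fun p =>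
      1 ≤ p.1 ∧ (p.1 = 1 → p.2 = true) ∧ (p.1 + 1 = m → p.2 = !τ))
    have mS : ∀ p δ, (p, δ) ∈ S ↔ (1 ≤ p ∧ p < m ∧ (p = 1 → δ = true) ∧ (p + 1 = m → δ = !τ)) := by
      intro p δ
      simp only [S, Finset.mem_filter, Finset.mem_product, Finset.mem_range, Finset.mem_univ]
      tauto
    have hS := winG (m - 3) S 1 true ⟨(mS _ _).2 ⟨le_rfl, by omega, by simp, by omega⟩,
        by rw [mS]; simp, by
        intro p δ h; exact ((mS _ _).1 h).1, by
        intro j δ h1 h2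
        exact (mS _ _).2 ⟨by omega, by omega, by omega, by omega⟩⟩
    refine Win.split (fun v => (v.1 : ℕ) = 0) (d1 := 1) (win_one _ ⟨(⟨0, by omega⟩, false), ?_⟩)
      (win_of_strip hm hS ?_ ?_ ?_ ?_) ?_ (by omega)
    · rw [Finset.mem_filter, hN]; simp
    · intro p δ h; have := (mS _ _).1 h; exact ⟨by omega, by omega, by omega⟩
    · intro h; have := (mS _ _).1 h; omega
    · intro δ
      rw [Finset.mem_filter, hN, mS]
      simp
    · intro k hk δ hk1
      rw [Finset.mem_filter, hN, mS]
      cases δ <;> cases τ <;> simp <;> omega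
    · rintro ⟨⟨p, hp⟩, ε⟩ hu hu1 ⟨⟨q, hq⟩, δ⟩ hv hv1
      have hu2 := (hN _ _ _).1 hu
      simp only at hu1
      obtain ⟨rfl, rfl⟩ : p = 0 ∧ ε = false := by
        rcases hu2 with h | h
        · exact h
        · omega
      exact (mem_delN.1 hv).2

theorem win_Lad_gen {m : ℕ} {τ : Bool} (hm : 2 ≤ m) :
    Win (Lad m τ) Finset.univ (m / 2) := by
  rcases Nat.lt_or_ge m 3 with h | h
  · obtain rfl : m = 2 := by omega
    exact win_one _ ⟨(0, false), Finset.mem_univ _⟩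
  · refine win_Lad h (by omega) ?_
    intro S hS _ _
    exact (winG _ S _ _ hS).mono (by omega)

theorem win_Lad_four {m : ℕ} {τ : Bool} (hm : 2 ≤ m)
    (h4 : (τ = true ∧ m % 4 = 1) ∨ (τ = false ∧ m % 4 = 3)) :
    Win (Lad m τ) Finset.univ ((m + 1) / 2) := by
  refine win_Lad (by omega) le_rfl ?_
  intro S hS h1 h2
  obtain ⟨k, rfl⟩ : ∃ k, m = 2 * k + 3 := ⟨(m - 3) / 2, by omega⟩
  have := winO k S 1 false hS (fun p δ h => by have := h1 p δ h; omega) (by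
    intro δ
    have := h2 δ
    rw [show 2 * k + 3 = 1 + 2 * k + 2 by ring] at this
    rw [this]
    rcases h4 with ⟨rfl, h⟩ | ⟨rfl, h⟩
    · rw [if_neg (by omega)]; simp
    · rw [if_pos (by omega)])
  exact this.mono (by omega)

/-- disjoint copies -/
def Cop (T : ℕ) {W : Type} (G : SimpleGraph W) : SimpleGraph (Fin T × W) where
  Adj p q := p.1 = q.1 ∧ G.Adj p.2 q.2
  symm := ⟨fun _ _ h => ⟨h.1.symm, h.2.symm⟩⟩
  loopless := ⟨fun _ h => G.loopless.irrefl _ h.2⟩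

theorem win_Cop {T : ℕ} {W : Type} [Fintype W] [DecidableEq W] {G : SimpleGraph W} {d : ℕ}
    (h : Win G Finset.univ d) : Win (Cop T G) Finset.univ (T * d) := by
  have key : ∀ s : Finset (Fin T), Win (Cop T G) (s ×ˢ Finset.univ) (s.card * d) := by
    intro s
    induction s using Finset.induction_on with
    | empty => simpa using win_zero _
    | insert c s hc ih =>
      rw [Finset.card_insert_of_notMem hc, add_mul, one_mul, add_comm]
      have h1 : Win (Cop T G) (Finset.univ.image (fun w : W => (c, w))) d :=
        h.image _ (by simp) (by intro u _ v _; simp [Cop])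
      have h2 := Win.union h1 ih (by
        rw [Finset.disjoint_left]
        rintro ⟨a, b⟩ ha hb
        simp at ha hb
        subst ha; exact hc hb) (by
        rintro ⟨a, b⟩ ha ⟨a', b'⟩ hb hadj
        simp at ha hb
        subst ha
        have : c = a' := hadj.1
        subst this; exact hc hb)
      convert h2 using 1
      ext ⟨a, b⟩
      simp
      tauto
  have := key Finset.univ
  simpa using this

end Cyc

set_option linter.unusedSectionVars false
set_option linter.unusedSimpArgs false

section CertSec

/-- transversals of the fibres of `β` over `0, …, d - 1` -/
def Transv {N : ℕ} (β : ℕ → ℕ) (d : ℕ) (F : Finset (Fin N)) : Prop :=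
  F.card = d ∧ ∀ i < d, ∃ x ∈ F, β (x : ℕ) = i

theorem Transv.lt {N : ℕ} {β : ℕ → ℕ} {d : ℕ} {F : Finset (Fin N)} (h : Transv β d F)
    {x : Fin N} (hx : x ∈ F) : β (x : ℕ) < d := by
  have h1 : Finset.range d ⊆ F.image (fun x : Fin N => β (x : ℕ)) := by
    intro i hi
    obtain ⟨y, hy, e⟩ := h.2 i (Finset.mem_range.1 hi)
    exact Finset.mem_image.2 ⟨y, hy, e⟩
  have h2 := Finset.eq_of_subset_of_card_le h1 (by
    rw [Finset.card_range]; exact Finset.card_image_le.trans h.1.le)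
  have : β (x : ℕ) ∈ Finset.range d := by
    rw [h2]; exact Finset.mem_image_of_mem (fun x : Fin N => β (x : ℕ)) hx
  exact Finset.mem_range.1 this

theorem Transv.inj {N : ℕ} {β : ℕ → ℕ} {d : ℕ} {F : Finset (Fin N)} (h : Transv β d F)
    {x y : Fin N} (hx : x ∈ F) (hy : y ∈ F) (e : β (x : ℕ) = β (y : ℕ)) : x = y := by
  have h1 : Finset.range d ⊆ F.image (fun x : Fin N => β (x : ℕ)) := by
    intro i hi
    obtain ⟨y, hy, e⟩ := h.2 i (Finset.mem_range.1 hi)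
    exact Finset.mem_image.2 ⟨y, hy, e⟩
  have h2 := Finset.card_le_card h1
  rw [Finset.card_range] at h2
  have h3 : (F.image (fun x : Fin N => β (x : ℕ))).card = F.card :=
    le_antisymm Finset.card_image_le (h.1.le.trans h2)
  exact Finset.card_image_iff.1 h3 hx hy e

theorem Transv.swap {N : ℕ} {β : ℕ → ℕ} {d : ℕ} {F : Finset (Fin N)} {w w' : Fin N}
    (h : Transv β d (F.erase w)) (hw : w ∈ F) (hw' : w' ∈ F)
    (e : β (w : ℕ) = β (w' : ℕ)) : Transv β d (F.erase w') := by
  refine ⟨?_, ?_⟩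
  · rw [← h.1, Finset.card_erase_of_mem hw, Finset.card_erase_of_mem hw']
  · intro i hi
    obtain ⟨x, hx, ex⟩ := h.2 i hi
    by_cases hxw : x = w'
    · subst hxw
      exact ⟨w, Finset.mem_erase.2 ⟨(Finset.ne_of_mem_erase hx).symm, hw⟩, e.trans ex⟩
    · exact ⟨x, Finset.mem_erase.2 ⟨hxw, Finset.mem_of_mem_erase hx⟩, ex⟩

def bt (d x : ℕ) : ℕ := if x % 2 = 0 then x / 4 else d

def rr (d x : ℕ) : ℕ := if x = 4 * d + 1 then 0 else x + 1

def bt' (d x : ℕ) : ℕ :=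
  if x = 4 * d + 1 then 0 else if x < 3 ∨ x % 4 = 1 then d else (x + 1) / 4

def ER (d x y : ℕ) : Prop :=
  (x % 4 = 0 ∧ y = x + 1) ∨ (x % 4 = 2 ∧ y = x + 1) ∨ (x % 4 = 0 ∧ y = x + 3) ∨
  (x % 4 = 1 ∧ y = x + 1) ∨ (x % 4 = 2 ∧ y = x + 2) ∨ (x % 4 = 3 ∧ y = x + 2) ∨
  (x = 4 * d ∧ y = 0) ∨ (x = 4 * d + 1 ∧ y = 1)

theorem er1 {d x y : ℕ} (h : x % 4 = 0) (e : y = x + 1) : ER d x y := Or.inl ⟨h, e⟩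
theorem er2 {d x y : ℕ} (h : x % 4 = 2) (e : y = x + 1) : ER d x y := Or.inr (Or.inl ⟨h, e⟩)
theorem er3 {d x y : ℕ} (h : x % 4 = 0) (e : y = x + 3) : ER d x y :=
  Or.inr (Or.inr (Or.inl ⟨h, e⟩))
theorem er4 {d x y : ℕ} (h : x % 4 = 1) (e : y = x + 1) : ER d x y :=
  Or.inr (Or.inr (Or.inr (Or.inl ⟨h, e⟩)))
theorem er5 {d x y : ℕ} (h : x % 4 = 2) (e : y = x + 2) : ER d x y :=
  Or.inr (Or.inr (Or.inr (Or.inr (Or.inl ⟨h, e⟩))))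
theorem er6 {d x y : ℕ} (h : x % 4 = 3) (e : y = x + 2) : ER d x y :=
  Or.inr (Or.inr (Or.inr (Or.inr (Or.inr (Or.inl ⟨h, e⟩)))))
theorem er7 {d x y : ℕ} (h : x = 4 * d) (e : y = 0) : ER d x y :=
  Or.inr (Or.inr (Or.inr (Or.inr (Or.inr (Or.inr (Or.inl ⟨h, e⟩))))))
theorem er8 {d x y : ℕ} (h : x = 4 * d + 1) (e : y = 1) : ER d x y :=
  Or.inr (Or.inr (Or.inr (Or.inr (Or.inr (Or.inr (Or.inr ⟨h, e⟩))))))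

theorem bt_lt {d x : ℕ} (h : bt d x < d) : x % 2 = 0 ∧ x < 4 * d ∧ bt d x = x / 4 := by
  unfold bt at *
  split_ifs at * <;> omega

theorem bt_even {d x : ℕ} (h : x % 2 = 0) : bt d x = x / 4 := by
  unfold bt; rw [if_pos h]

theorem bt'_lt {d x : ℕ} (hd : 1 ≤ d) (h : bt' d x < d) : (x = 4 * d + 1 ∧ bt' d x = 0) ∨
    (3 ≤ x ∧ x % 4 ≠ 1 ∧ x + 1 < 4 * d ∧ bt' d x = (x + 1) / 4) := by
  unfold bt' at *
  split_ifs at * <;> omega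

theorem bt'_ge {d x : ℕ} (h3 : 3 ≤ x) (h4 : x % 4 ≠ 1) : bt' d x = (x + 1) / 4 := by
  unfold bt'; rw [if_neg (by omega), if_neg (by omega)]

theorem bt'_zero {d : ℕ} : bt' d (4 * d + 1) = 0 := by
  unfold bt'; rw [if_pos rfl]

theorem bt'_ge_d {d x : ℕ} (hx : x < 4 * d + 2) (h : d ≤ bt' d x) (hd : 1 ≤ d) :
    (x < 3 ∨ (x % 4 = 1 ∧ x < 4 * d) ∨ x = 4 * d ∨ x + 1 = 4 * d) := by
  unfold bt' at *
  split_ifs at * <;> omega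

set_option maxHeartbeats 1000000 in
theorem coc_aux {N d : ℕ} (hd : 1 ≤ d) (hN : N = 4 * d ∨ N = 4 * d + 2) (G : SimpleGraph (Fin N))
    (hE : ∀ x y : Fin N, ER d x y → G.Adj x y) (F : Finset (Fin N)) (hF : Indep G F)
    (w : Fin N) (hw : w ∈ F)
    (hFam : Transv (bt d) d (F.erase w) ∨ Transv (bt' d) d (F.erase w)) :
    ∃ w' ∈ F, w' ≠ w ∧ (Transv (bt d) d (F.erase w') ∨ Transv (bt' d) d (F.erase w')) ∧
    (∀ z ∈ F, ¬ (rr d w < rr d z ∧ rr d z < rr d w') ∧ ¬ (rr d w' < rr d z ∧ rr d z < rr d w)) ∧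
    ∀ w'' ∈ F, (Transv (bt d) d (F.erase w'') ∨ Transv (bt' d) d (F.erase w'')) →
      w'' = w ∨ w'' = w' := by
  have noE : ∀ x ∈ F, ∀ y ∈ F, ¬ ER d x y := fun x hx y hy h => hF x hx y hy (hE x y h)
  have hwN := w.2
  rcases hFam with hT | hT
  · have hel : ∀ z ∈ F, z ≠ w → (z : ℕ) % 2 = 0 ∧ (z : ℕ) < 4 * d ∧ bt d z = (z : ℕ) / 4 := by
      intro z hz hzw
      exact bt_lt (hT.lt (Finset.mem_erase.2 ⟨hzw, hz⟩))
    have hrep : ∀ i < d, ∃ x ∈ F, x ≠ w ∧ ((x : ℕ) = 4 * i ∨ (x : ℕ) = 4 * i + 2) := by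
      intro i hi
      obtain ⟨x, hx, e⟩ := hT.2 i hi
      rw [Finset.mem_erase] at hx
      have := hel x hx.2 hx.1
      exact ⟨x, hx.2, hx.1, by omega⟩
    have huq : ∀ z ∈ F, z ≠ w → ∀ z' ∈ F, z' ≠ w → (z : ℕ) / 4 = (z' : ℕ) / 4 → z = z' := by
      intro z hz hzw z' hz' hzw' e
      have h1 := hel z hz hzw
      have h2 := hel z' hz' hzw'
      exact hT.inj (Finset.mem_erase.2 ⟨hzw, hz⟩) (Finset.mem_erase.2 ⟨hzw', hz'⟩) (by omega)
    by_cases hcase : (w : ℕ) < 4 * d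
    · obtain ⟨w', hw', hne, hv⟩ := hrep ((w : ℕ) / 4) (by omega)
      by_cases hev : (w : ℕ) % 2 = 0
      · have hbe : bt d w = bt d w' := by
          rw [bt_even hev, (hel w' hw' hne).2.2]; omega
        refine ⟨w', hw', hne, Or.inl (hT.swap hw hw' hbe), ?_, ?_⟩
        · intro z hz
          by_cases hzw : z = w
          · subst hzw; omega
          by_cases hzw' : z = w'
          · subst hzw'; omega
          have h1 := hel z hz hzw
          have h2 : (z : ℕ) / 4 ≠ (w' : ℕ) / 4 := fun h => hzw' (huq z hz hzw w' hw' hne h)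
          unfold rr
          rw [if_neg (by omega), if_neg (by omega), if_neg (by omega)]
          omega
        · intro w'' hw'' h
          by_contra hc
          push Not at hc
          rcases h with h | h
          · exact hne (h.inj (Finset.mem_erase.2 ⟨hc.2.symm, hw'⟩)
              (Finset.mem_erase.2 ⟨hc.1.symm, hw⟩) hbe.symm)
          · obtain ⟨x, hx, e⟩ := h.2 0 (by omega)
            rw [Finset.mem_erase] at hx
            have h3 := bt'_lt hd (show bt' d x < d by omega)
            have h4 : (x : ℕ) < 4 * d := by
              by_cases hxw : x = w
              · subst hxw; exact hcase
              · exact (hel x hx.2 hxw).2.1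
            omega
      · exfalso
        rcases hv with hv | hv
        · by_cases h4 : (w : ℕ) % 4 = 1
          · exact noE w' hw' w hw (er1 (by omega) (by omega))
          · exact noE w' hw' w hw (er3 (by omega) (by omega))
        · by_cases h4 : (w : ℕ) % 4 = 1
          · exact noE w hw w' hw' (er4 (by omega) (by omega))
          · exact noE w' hw' w hw (er2 (by omega) (by omega))
    · by_cases hcase2 : (w : ℕ) = 4 * d
      · exfalso
        have hall : ∀ i < d, ∃ x ∈ F, (x : ℕ) = 4 * i + 2 := by
          intro i
          induction i with
          | zero =>
            intro hi
            obtain ⟨x, hx, hxw, e⟩ := hrep 0 hi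
            refine ⟨x, hx, ?_⟩
            rcases e with e | e
            · exact absurd (er7 hcase2 (by omega)) (noE w hw x hx)
            · exact e
          | succ i ih =>
            intro hi
            obtain ⟨y, hy, ey⟩ := ih (by omega)
            obtain ⟨x, hx, hxw, e⟩ := hrep (i + 1) hi
            refine ⟨x, hx, ?_⟩
            rcases e with e | e
            · exact absurd (er5 (by omega) (by omega)) (noE y hy x hx)
            · exact e
        obtain ⟨x, hx, e⟩ := hall (d - 1) (by omega)
        exact noE x hx w hw (er5 (by omega) (by omega))
      · have hw1 : (w : ℕ) = 4 * d + 1 := by omega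
        obtain ⟨w', hw', hne, hv⟩ := hrep 0 (by omega)
        refine ⟨w', hw', hne, Or.inr ⟨?_, ?_⟩, ?_, ?_⟩
        · rw [← hT.1, Finset.card_erase_of_mem hw, Finset.card_erase_of_mem hw']
        · intro i hi
          rcases Nat.eq_zero_or_pos i with rfl | hi0
          · exact ⟨w, Finset.mem_erase.2 ⟨hne.symm, hw⟩, by rw [hw1, bt'_zero]⟩
          · obtain ⟨x, hx, hxw, e⟩ := hrep i hi
            refine ⟨x, Finset.mem_erase.2 ⟨?_, hx⟩, ?_⟩
            · rintro rfl; omega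
            · rw [bt'_ge (by omega) (by omega)]; omega
        · intro z hz
          by_cases hzw : z = w
          · subst hzw; omega
          by_cases hzw' : z = w'
          · subst hzw'; omega
          have h1 := hel z hz hzw
          have h2 : (z : ℕ) / 4 ≠ (w' : ℕ) / 4 := fun h => hzw' (huq z hz hzw w' hw' hne h)
          unfold rr
          rw [if_pos (by omega), if_neg (by omega), if_neg (by omega)]
          omega
        · intro w'' hw'' h
          by_contra hc
          push Not at hc
          rcases h with h | h
          · have := bt_lt (h.lt (Finset.mem_erase.2 ⟨hc.1.symm, hw⟩))
            omega
          · have := bt'_lt hd (h.lt (Finset.mem_erase.2 ⟨hc.2.symm, hw'⟩))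
            omega
  · have hel : ∀ z ∈ F, z ≠ w → ((z : ℕ) = 4 * d + 1 ∧ bt' d z = 0) ∨
        (3 ≤ (z : ℕ) ∧ (z : ℕ) % 4 ≠ 1 ∧ (z : ℕ) + 1 < 4 * d ∧ bt' d z = ((z : ℕ) + 1) / 4) := by
      intro z hz hzw
      exact bt'_lt hd (hT.lt (Finset.mem_erase.2 ⟨hzw, hz⟩))
    have hrep : ∀ i < d, 1 ≤ i → ∃ x ∈ F, x ≠ w ∧
        ((x : ℕ) + 1 = 4 * i ∨ (x : ℕ) = 4 * i ∨ (x : ℕ) = 4 * i + 2) := by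
      intro i hi h1
      obtain ⟨x, hx, e⟩ := hT.2 i hi
      rw [Finset.mem_erase] at hx
      have := hel x hx.2 hx.1
      exact ⟨x, hx.2, hx.1, by omega⟩
    obtain ⟨u, hu, huw, hu1⟩ : ∃ u ∈ F, u ≠ w ∧ (u : ℕ) = 4 * d + 1 := by
      obtain ⟨x, hx, e⟩ := hT.2 0 (by omega)
      rw [Finset.mem_erase] at hx
      have := hel x hx.2 hx.1
      exact ⟨x, hx.2, hx.1, by omega⟩
    have hwu : (w : ℕ) ≠ 4 * d + 1 := fun h => huw (Fin.ext (hu1.trans h.symm))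
    have huq : ∀ z ∈ F, z ≠ w → ∀ z' ∈ F, z' ≠ w → bt' d z = bt' d z' → z = z' := by
      intro z hz hzw z' hz' hzw' e
      exact hT.inj (Finset.mem_erase.2 ⟨hzw, hz⟩) (Finset.mem_erase.2 ⟨hzw', hz'⟩) e
    by_cases hcase : bt' d w < d
    · have hw3 := bt'_lt hd hcase
      obtain ⟨w', hw', hne, hv⟩ := hrep (((w : ℕ) + 1) / 4) (by omega) (by omega)
      have hw'3 := hel w' hw' hne
      have hbe : bt' d w = bt' d w' := by omega
      refine ⟨w', hw', hne, Or.inr (hT.swap hw hw' hbe), ?_, ?_⟩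
      · intro z hz
        by_cases hzw : z = w
        · subst hzw; omega
        by_cases hzw' : z = w'
        · subst hzw'; omega
        have h1 := hel z hz hzw
        have h2 : bt' d z ≠ bt' d w' := fun h => hzw' (huq z hz hzw w' hw' hne h)
        unfold rr
        rw [if_neg (show ¬ (w : ℕ) = 4 * d + 1 by omega),
          if_neg (show ¬ (w' : ℕ) = 4 * d + 1 by omega)]
        split_ifs <;> omega
      · intro w'' hw'' h
        by_contra hc
        push Not at hc
        rcases h with h | h
        · have e1 := bt_lt (h.lt (Finset.mem_erase.2 ⟨hc.1.symm, hw⟩))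
          have e2 := bt_lt (h.lt (Finset.mem_erase.2 ⟨hc.2.symm, hw'⟩))
          exact hne (h.inj (Finset.mem_erase.2 ⟨hc.2.symm, hw'⟩)
              (Finset.mem_erase.2 ⟨hc.1.symm, hw⟩) (by omega))
        · exact hne (h.inj (Finset.mem_erase.2 ⟨hc.2.symm, hw'⟩)
              (Finset.mem_erase.2 ⟨hc.1.symm, hw⟩) hbe.symm)
    · have h5 := bt'_ge_d (show (w : ℕ) < 4 * d + 2 by omega) (by omega) hd
      by_cases hw02 : (w : ℕ) = 0 ∨ (w : ℕ) = 2
      · have hno : ∀ j, 1 ≤ j → j < d → ∀ z ∈ F, (z : ℕ) + 1 ≠ 4 * j := by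
          intro j hj
          induction j, hj using Nat.le_induction with
          | base =>
            intro _ z hz h
            rcases hw02 with e | e
            · exact noE w hw z hz (er3 (by omega) (by omega))
            · exact noE w hw z hz (er2 (by omega) (by omega))
          | succ j hj ih =>
            intro hjd z hz h
            obtain ⟨x, hx, hxw, e⟩ := hrep j (by omega) hj
            have e2 := ih (by omega) x hx
            rcases e with e | e | e
            · exact e2 e
            · exact noE x hx z hz (er3 (by omega) (by omega))
            · exact noE x hx z hz (er2 (by omega) (by omega))
        refine ⟨u, hu, huw, Or.inl ⟨?_, ?_⟩, ?_, ?_⟩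
        · rw [← hT.1, Finset.card_erase_of_mem hw, Finset.card_erase_of_mem hu]
        · intro i hi
          rcases Nat.eq_zero_or_pos i with rfl | hi0
          · exact ⟨w, Finset.mem_erase.2 ⟨huw.symm, hw⟩, by
              rw [bt_even (by omega)]; omega⟩
          · obtain ⟨x, hx, hxw, e⟩ := hrep i hi hi0
            have e2 := hno i hi0 hi x hx
            refine ⟨x, Finset.mem_erase.2 ⟨?_, hx⟩, ?_⟩
            · rintro rfl; omega
            · rw [bt_even (by omega)]; omega
        · intro z hz
          by_cases hzw : z = w
          · subst hzw; omega
          by_cases hzw' : z = u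
          · subst hzw'; omega
          have h1 := hel z hz hzw
          have h2 : (z : ℕ) ≠ 4 * d + 1 := fun h => hzw' (Fin.ext (h.trans hu1.symm))
          unfold rr
          rw [if_neg (by omega), if_neg (by omega), if_pos (by omega)]
          omega
        · intro w'' hw'' h
          by_contra hc
          push Not at hc
          rcases h with h | h
          · have := bt_lt (h.lt (Finset.mem_erase.2 ⟨hc.2.symm, hu⟩))
            omega
          · have := h.lt (Finset.mem_erase.2 ⟨hc.1.symm, hw⟩)
            omega
      · exfalso
        by_cases hw1 : (w : ℕ) = 1
        · exact noE u hu w hw (er8 hu1 hw1)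
        by_cases hw4 : (w : ℕ) % 4 = 1
        · obtain ⟨x, hx, hxw, e⟩ := hrep ((w : ℕ) / 4) (by omega) (by omega)
          rcases e with e | e | e
          · exact noE x hx w hw (er6 (by omega) (by omega))
          · exact noE x hx w hw (er1 (by omega) (by omega))
          · exact noE w hw x hx (er4 (by omega) (by omega))
        by_cases hw5 : (w : ℕ) = 4 * d
        · exact noE w hw u hu (er1 (by omega) (by omega))
        · exact noE w hw u hu (er6 (by omega) (by omega))

/-- the certificate of a component -/
def certComp {N d : ℕ} (hd : 1 ≤ d) (hN : N = 4 * d ∨ N = 4 * d + 2) (G : SimpleGraph (Fin N))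
    (hE : ∀ x y : Fin N, ER d x y → G.Adj x y)
    (hno : ∀ x y : Fin N, (x : ℕ) % 4 ≤ 1 → (y : ℕ) % 4 ≤ 1 → (x : ℕ) < 4 * d → (y : ℕ) < 4 * d →
      (x : ℕ) / 4 ≠ (y : ℕ) / 4 → ¬ G.Adj x y) : Cert G d where
  ρ x := rr d x
  hρ := by
    intro x y h
    simp only [rr] at h
    apply Fin.ext
    split_ifs at h <;> omega
  Fam F := Transv (bt d) d F ∨ Transv (bt' d) d F
  hcard := by
    rintro F (h | h)
    · exact h.1
    · exact h.1
  coc := fun F hF w hw h => coc_aux hd hN G hE F hF w hw h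
  ι := Fin d
  fι := inferInstance
  hι := Fintype.card_fin d
  ch i ε := ⟨4 * (i : ℕ) + (if ε then 1 else 0), by have := i.2; split_ifs <;> omega⟩
  hord := by
    intro i j hij
    have : (i : ℕ) ≠ (j : ℕ) := fun h => hij (Fin.ext h)
    have h1 := i.2
    have h2 := j.2
    rcases Nat.lt_or_ge (i : ℕ) (j : ℕ) with h | h
    · left
      intro ε ε'
      simp only [rr]
      split_ifs <;> omega
    · right
      intro ε ε'
      simp only [rr]
      split_ifs <;> omega
  hind := by
    intro i j hij ε ε'
    have : (i : ℕ) ≠ (j : ℕ) := fun h => hij (Fin.ext h)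
    have h1 := i.2
    have h2 := j.2
    apply hno <;> simp only <;> split_ifs <;> omega
  hFam := by
    intro ε
    have hmem : ∀ x : Fin N, x ∈ (Finset.univ.image (fun i : Fin d =>
        (⟨4 * (i : ℕ) + (if ε i then 1 else 0), by have := i.2; split_ifs <;> omega⟩ : Fin N))) ↔
        ∃ i : Fin d, (x : ℕ) = 4 * (i : ℕ) + (if ε i then 1 else 0) := by
      intro x
      simp only [Finset.mem_image, Finset.mem_univ, true_and, Fin.ext_iff]
      exact ⟨fun ⟨i, h⟩ => ⟨i, h.symm⟩, fun ⟨i, h⟩ => ⟨i, h.symm⟩⟩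
    constructor
    · rintro (h | h)
      · intro i
        by_contra hc
        have hc' : ε i = true := by simpa using hc
        have hi := i.2
        have := bt_lt (h.lt ((hmem ⟨4 * (i : ℕ) + 1, by omega⟩).2 ⟨i, by rw [if_pos hc']⟩))
        simp only at this
        omega
      · exfalso
        obtain ⟨x, hx, e⟩ := h.2 0 (by omega)
        have h3 := bt'_lt hd (show bt' d x < d by omega)
        obtain ⟨i, hi⟩ := (hmem x).1 hx
        have := i.2
        split_ifs at hi <;> omega
    · intro h
      left
      refine ⟨?_, ?_⟩
      · rw [Finset.card_image_of_injective, Finset.card_univ, Fintype.card_fin]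
        intro i j hij
        simp only [Fin.mk.injEq, h] at hij
        apply Fin.ext
        simpa using hij
      · intro i hi
        refine ⟨⟨4 * i, by omega⟩, (hmem _).2 ⟨⟨i, hi⟩, by rw [h]; simp⟩, ?_⟩
        rw [bt_even (by simp only; omega)]
        simp only
        omega

end CertSec

set_option linter.unusedSectionVars false
set_option linter.unusedSimpArgs false

section Transport

variable {V W : Type} [Fintype V] [DecidableEq V] [Fintype W] [DecidableEq W]

theorem image_symm_erase (e : V ≃ W) (F : Finset W) (w : W) :
    (F.erase w).image e.symm = (F.image e.symm).erase (e.symm w) := by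
  ext x
  simp only [Finset.mem_image, Finset.mem_erase]
  constructor
  · rintro ⟨a, ⟨h1, h2⟩, rfl⟩
    exact ⟨fun h => h1 (e.symm.injective h), a, h2, rfl⟩
  · rintro ⟨h1, a, h2, rfl⟩
    exact ⟨a, ⟨fun h => h1 (by rw [h]), h2⟩, rfl⟩

/-- transport of certificates -/
def Cert.map {G : SimpleGraph V} {H : SimpleGraph W} {d : ℕ} (C : Cert G d) (e : V ≃ W)
    (h : ∀ u v, H.Adj (e u) (e v) ↔ G.Adj u v) : Cert H d where
  ρ := fun w => C.ρ (e.symm w)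
  hρ := C.hρ.comp e.symm.injective
  Fam F := C.Fam (F.image e.symm)
  hcard F hF := by
    rw [← C.hcard _ hF, Finset.card_image_of_injective _ e.symm.injective]
  coc := by
    intro F hF w hw hFam
    rw [image_symm_erase] at hFam
    obtain ⟨w', hw', hne, h1, h2, h3⟩ := C.coc (F.image e.symm) (by
      intro u hu v hv
      rw [Finset.mem_image] at hu hv
      obtain ⟨u', hu', rfl⟩ := hu
      obtain ⟨v', hv', rfl⟩ := hv
      rw [← h]
      simpa using hF u' hu' v' hv') (e.symm w) (Finset.mem_image_of_mem _ hw) hFam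
    rw [Finset.mem_image] at hw'
    obtain ⟨w1, hw1, rfl⟩ := hw'
    refine ⟨w1, hw1, fun hh => hne (by rw [hh]), ?_, ?_, ?_⟩
    · rw [image_symm_erase]; exact h1
    · intro z hz
      exact h2 _ (Finset.mem_image_of_mem _ hz)
    · intro w2 hw2 hF2
      rw [image_symm_erase] at hF2
      rcases h3 _ (Finset.mem_image_of_mem _ hw2) hF2 with hh | hh
      · exact Or.inl (e.symm.injective hh)
      · exact Or.inr (e.symm.injective hh)
  ι := C.ι
  fι := C.fι
  hι := C.hι
  ch i ε := e (C.ch i ε)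
  hord := by
    intro i j hij
    simpa using C.hord i j hij
  hind := by
    intro i j hij ε ε'
    rw [h]
    exact C.hind i j hij ε ε'
  hFam := by
    intro ε
    rw [← C.hFam ε, Finset.image_image]
    have : (⇑e.symm ∘ fun i => e (C.ch i (ε i))) = fun i => C.ch i (ε i) := by
      funext i; simp
    rw [this]

/-- slices -/
def slc {T : ℕ} (F : Finset (Fin T × V)) (c : Fin T) : Finset V :=
  Finset.univ.filter (fun x => (c, x) ∈ F)

theorem mem_slc {T : ℕ} {F : Finset (Fin T × V)} {c : Fin T} {x : V} :
    x ∈ slc F c ↔ (c, x) ∈ F := by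
  simp [slc]

theorem card_slc {T : ℕ} (F : Finset (Fin T × V)) : F.card = ∑ c, (slc F c).card := by
  rw [Finset.card_eq_sum_card_fiberwise (f := Prod.fst) (t := Finset.univ) (by simp)]
  refine Finset.sum_congr rfl ?_
  intro c _
  symm
  refine Finset.card_bij (fun x _ => (c, x)) ?_ ?_ ?_
  · intro x hx
    simpa using mem_slc.1 hx
  · intro x _ y _ h
    simpa using h
  · rintro ⟨a, x⟩ h
    simp only [Finset.mem_filter] at h
    obtain ⟨h1, rfl⟩ := h
    exact ⟨x, mem_slc.2 h1, rfl⟩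

theorem slc_erase_same {T : ℕ} (F : Finset (Fin T × V)) (c : Fin T) (x : V) :
    slc (F.erase (c, x)) c = (slc F c).erase x := by
  ext y
  simp [mem_slc]

theorem slc_erase_ne {T : ℕ} (F : Finset (Fin T × V)) {c c' : Fin T} (h : c' ≠ c) (x : V) :
    slc (F.erase (c, x)) c' = slc F c' := by
  ext y
  simp [mem_slc, h]

theorem lex_lt {T B : ℕ} {c c' : Fin T} (h : c < c') {p q : ℕ} (hp : p < B) :
    (c : ℕ) * B + p < (c' : ℕ) * B + q := by
  have h1 : (c : ℕ) + 1 ≤ (c' : ℕ) := h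
  have := Nat.mul_le_mul_right B h1
  rw [add_mul] at this
  omega

theorem exists_bound (f : V → ℕ) : ∃ B, ∀ x, f x < B :=
  ⟨(Finset.univ.sup f) + 1, fun x => Nat.lt_succ_of_le (Finset.le_sup (Finset.mem_univ x))⟩

theorem Cert.cop {G : SimpleGraph V} {d : ℕ} (C : Cert G d) (T : ℕ) :
    Nonempty (Cert (Cop T G) (T * d)) := by
  obtain ⟨B, hB⟩ := exists_bound C.ρ
  letI := C.fι
  refine ⟨{
    ρ := fun p => (p.1 : ℕ) * B + C.ρ p.2
    hρ := ?_
    Fam := fun F => ∀ c, C.Fam (slc F c)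
    hcard := ?_
    coc := ?_
    ι := Fin T × C.ι
    fι := inferInstance
    hι := by rw [Fintype.card_prod, Fintype.card_fin, C.hι]
    ch := fun i ε => (i.1, C.ch i.2 ε)
    hord := ?_
    hind := ?_
    hFam := ?_ }⟩
  · rintro ⟨c, x⟩ ⟨c', y⟩ h
    simp only at h
    rcases lt_trichotomy c c' with hc | rfl | hc
    · exact absurd h (lex_lt hc (hB x)).ne
    · rw [C.hρ (by omega : C.ρ x = C.ρ y)]
    · exact absurd h (lex_lt hc (hB y)).ne'
  · intro F hF
    rw [card_slc, Finset.sum_congr rfl (fun c _ => C.hcard _ (hF c))]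
    simp
  · rintro F hF ⟨c, x⟩ hw hFam
    have hc := hFam c
    rw [slc_erase_same] at hc
    obtain ⟨x', hx', hne, h1, h2, h3⟩ := C.coc (slc F c) (by
      intro u hu v hv hadj
      exact hF _ (mem_slc.1 hu) _ (mem_slc.1 hv) ⟨rfl, hadj⟩) x (mem_slc.2 hw) hc
    refine ⟨(c, x'), mem_slc.1 hx', by simpa using hne, ?_, ?_, ?_⟩
    · intro c'
      by_cases hcc : c' = c
      · subst hcc; rw [slc_erase_same]; exact h1
      · rw [slc_erase_ne _ hcc]
        have := hFam c'
        rwa [slc_erase_ne _ hcc] at this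
    · rintro ⟨c', z⟩ hz
      simp only
      rcases lt_trichotomy c' c with hc | rfl | hc
      · have e1 := lex_lt (q := C.ρ x) hc (hB z)
        have e2 := lex_lt (q := C.ρ x') hc (hB z)
        omega
      · have := h2 z (mem_slc.2 hz)
        omega
      · have e1 := lex_lt (q := C.ρ z) hc (hB x)
        have e2 := lex_lt (q := C.ρ z) hc (hB x')
        omega
    · rintro ⟨c', y⟩ hy hFy
      have h4 := hFy c
      by_cases hcc : c = c'
      · subst hcc
        rw [slc_erase_same] at h4
        rcases h3 y (mem_slc.2 hy) h4 with h | h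
        · left; rw [h]
        · right; rw [h]
      · rw [slc_erase_ne _ hcc] at h4
        have e1 := C.hcard _ h4
        have e2 := C.hcard _ hc
        have e3 := Finset.card_erase_lt_of_mem (mem_slc.2 hw)
        omega
  · rintro ⟨c, i⟩ ⟨c', j⟩ hij
    simp only
    rcases lt_trichotomy c c' with hc | rfl | hc
    · left; intro ε ε'; exact lex_lt hc (hB _)
    · rcases C.hord i j (fun h => hij (by rw [h])) with h | h
      · left; intro ε ε'; have := h ε ε'; omega
      · right; intro ε ε'; have := h ε ε'; omega
    · right; intro ε ε'; exact lex_lt hc (hB _)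
  · rintro ⟨c, i⟩ ⟨c', j⟩ hij ε ε' ⟨h1, h2⟩
    simp only at h1 h2
    subst h1
    exact C.hind i j (fun h => hij (by rw [h])) ε ε' h2
  · intro ε
    have key : ∀ c, slc (Finset.univ.image (fun i : Fin T × C.ι => (i.1, C.ch i.2 (ε i)))) c =
        Finset.univ.image (fun i => C.ch i (ε (c, i))) := by
      intro c
      ext x
      simp only [mem_slc, Finset.mem_image, Finset.mem_univ, true_and, Prod.mk.injEq]
      constructor
      · rintro ⟨⟨c', i⟩, h1, h2⟩
        simp only at h1 h2
        subst h1
        exact ⟨i, h2⟩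
      · rintro ⟨i, h⟩
        exact ⟨(c, i), rfl, h⟩
    simp only [key]
    constructor
    · rintro h ⟨c, i⟩
      exact (C.hFam (fun i => ε (c, i))).1 (h c) i
    · intro h c
      exact (C.hFam (fun i => ε (c, i))).2 (fun i => h (c, i))

/-- existence of a maximal independent set of size `d` -/
def MaxInd (G : SimpleGraph V) (d : ℕ) : Prop :=
  ∃ F : Finset V, Indep G F ∧ (∀ v ∉ F, ∃ u ∈ F, G.Adj u v) ∧ F.card = d

theorem MaxInd.map {G : SimpleGraph V} {H : SimpleGraph W} {d : ℕ} (C : MaxInd G d) (e : V ≃ W)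
    (h : ∀ u v, H.Adj (e u) (e v) ↔ G.Adj u v) : MaxInd H d := by
  obtain ⟨F, h1, h2, h3⟩ := C
  refine ⟨F.image e, ?_, ?_, ?_⟩
  · intro u hu v hv
    rw [Finset.mem_image] at hu hv
    obtain ⟨u', hu', rfl⟩ := hu
    obtain ⟨v', hv', rfl⟩ := hv
    rw [h]
    exact h1 u' hu' v' hv'
  · intro v hv
    obtain ⟨u, hu, ha⟩ := h2 (e.symm v) (fun hh => hv (Finset.mem_image.2 ⟨_, hh, by simp⟩))
    refine ⟨e u, Finset.mem_image_of_mem _ hu, ?_⟩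
    rw [← h] at ha
    simpa using ha
  · rw [Finset.card_image_of_injective _ e.injective, h3]

theorem MaxInd.cop {G : SimpleGraph V} {d : ℕ} (C : MaxInd G d) (T : ℕ) :
    MaxInd (Cop T G) (T * d) := by
  obtain ⟨F, h1, h2, h3⟩ := C
  refine ⟨Finset.univ ×ˢ F, ?_, ?_, ?_⟩
  · rintro ⟨c, u⟩ hu ⟨c', v⟩ hv hadj
    simp only [Finset.mem_product] at hu hv
    exact h1 u hu.2 v hv.2 hadj.2
  · rintro ⟨c, v⟩ hv
    obtain ⟨u, hu, ha⟩ := h2 v (by simpa using hv)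
    exact ⟨(c, u), by simpa using hu, rfl, ha⟩
  · simp [h3]

/-- combinatorial lower bound witnesses -/
def LBd (G : SimpleGraph V) (d : ℕ) : Prop := Nonempty (Cert G d) ∨ MaxInd G d

theorem LBd.map {G : SimpleGraph V} {H : SimpleGraph W} {d : ℕ} (C : LBd G d) (e : V ≃ W)
    (h : ∀ u v, H.Adj (e u) (e v) ↔ G.Adj u v) : LBd H d := by
  rcases C with ⟨⟨C⟩⟩ | C
  · exact Or.inl ⟨C.map e h⟩
  · exact Or.inr (C.map e h)

theorem LBd.cop {G : SimpleGraph V} {d : ℕ} (C : LBd G d) (T : ℕ) :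
    LBd (Cop T G) (T * d) := by
  rcases C with ⟨⟨C⟩⟩ | C
  · exact Or.inl (C.cop T)
  · exact Or.inr (C.cop T)

theorem pdim_of_comb (K : Type*) [Field K] {G : SimpleGraph V} {d : ℕ}
    (hW : Win G Finset.univ d) (hL : LBd G d) :
    pdimQuot (edgeIdeal K G) = Fintype.card V - d := by
  rw [edgeIdeal_eq_Jid]
  have h1 : (Fintype.card V - d) ∈ {n : ℕ | pdimLE (MvPolynomial V K) n
    (MvPolynomial V K ⧸ Jid K G Finset.univ)} := hW.pdimLE
  refine le_antisymm (Nat.sInf_le h1) ?_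
  refine le_csInf ⟨_, h1⟩ ?_
  intro n hn
  by_contra hc
  push Not at hc
  rcases hL with ⟨⟨C⟩⟩ | ⟨F, hF, hm, hcard⟩
  · exact C.LB (by omega) hn
  · exact LB_maxIndep hF hm (by omega) hn

theorem pdim_of_comp (K : Type*) [Field K] {T d : ℕ} {G : SimpleGraph V} {H : SimpleGraph W}
    (hW : Win G Finset.univ d) (hL : LBd G d) (e : Fin T × V ≃ W)
    (h : ∀ u v, H.Adj (e u) (e v) ↔ (Cop T G).Adj u v) :
    pdimQuot (edgeIdeal K H) = Fintype.card W - T * d := by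
  refine pdim_of_comb K ?_ ((hL.cop T).map e h)
  have := (win_Cop (T := T) hW).image e (fun x _ y _ hxy => e.injective hxy)
    (fun u _ v _ => h u v)
  rwa [Finset.image_univ_of_surjective e.surjective] at this

end Transport

set_option linter.unusedSectionVars false
set_option linter.unusedSimpArgs false

section LadLB

def rw' (x : ℕ) : Bool := decide ((x + (x + 2) / 4) % 2 = 1)

theorem rw'_eq {x y : ℕ} (h : (x + (x + 2) / 4) % 2 = (y + (y + 2) / 4) % 2) : rw' x = rw' y := by
  unfold rw'; rw [h]

theorem rw'_ne {x y : ℕ} (h : (x + (x + 2) / 4) % 2 ≠ (y + (y + 2) / 4) % 2) :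
    rw' x = !rw' y := by
  unfold rw'
  rw [← decide_not]
  apply decide_eq_decide.2
  omega

theorem lad_cert {m d : ℕ} {τ : Bool} (hd : 1 ≤ d)
    (hm : m = 2 * d ∨ (m = 2 * d + 1 ∧ τ = decide (d % 2 = 1))) :
    LBd (Lad m τ) d := by
  have hm2 : 2 ≤ m := by omega
  let f : Fin (2 * m) → Fin m × Bool := fun x => (⟨(x : ℕ) / 2, by have := x.2; omega⟩, rw' x)
  have hf : Function.Bijective f := by
    rw [Fintype.bijective_iff_injective_and_card]
    refine ⟨?_, by simp [mul_comm]⟩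
    intro x y h
    simp only [f, Prod.mk.injEq, Fin.mk.injEq, rw', decide_eq_decide] at h
    obtain ⟨h1, h2⟩ := h
    have h3 : ((x : ℕ) + 2) / 4 = ((y : ℕ) + 2) / 4 := by omega
    rw [h3] at h2
    apply Fin.ext
    omega
  let e : Fin (2 * m) ≃ Fin m × Bool := Equiv.ofBijective f hf
  have he : ∀ x, e x = (⟨(x : ℕ) / 2, by have := x.2; omega⟩, rw' x) := fun x => rfl
  refine LBd.map (G := (Lad m τ).comap e) (Or.inl ⟨certComp hd (by omega) _ ?_ ?_⟩) e ?_
  · intro x y hE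
    rw [SimpleGraph.comap_adj, he, he, Lad_adj hm2]
    left
    have hx := x.2
    have hy := y.2
    simp only [lrel]
    rcases hE with h | h | h | h | h | h | h | h
    · exact Or.inl ⟨by omega, rw'_ne (by omega)⟩
    · exact Or.inl ⟨by omega, rw'_ne (by omega)⟩
    · exact Or.inr (Or.inl ⟨rw'_eq (by omega), by omega⟩)
    · exact Or.inr (Or.inl ⟨rw'_eq (by omega), by omega⟩)
    · exact Or.inr (Or.inl ⟨rw'_eq (by omega), by omega⟩)
    · exact Or.inr (Or.inl ⟨rw'_eq (by omega), by omega⟩)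
    · obtain ⟨h1, rfl⟩ : m = 2 * d + 1 ∧ τ = decide (d % 2 = 1) := by
        rcases hm with h' | h'
        · omega
        · exact h'
      refine Or.inr (Or.inr ⟨by omega, by omega, ?_⟩)
      have e1 : rw' (y : ℕ) = false := by
        unfold rw'; rw [h.2]; decide
      have e2 : rw' (x : ℕ) = decide (d % 2 = 1) := by
        unfold rw'; apply decide_eq_decide.2; omega
      rw [e1, e2]; simp
    · obtain ⟨h1, rfl⟩ : m = 2 * d + 1 ∧ τ = decide (d % 2 = 1) := by
        rcases hm with h' | h'
        · omega
        · exact h'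
      refine Or.inr (Or.inr ⟨by omega, by omega, ?_⟩)
      have e1 : rw' (y : ℕ) = true := by
        unfold rw'; rw [h.2]; decide
      have e2 : rw' (x : ℕ) = !decide (d % 2 = 1) := by
        unfold rw'; rw [← decide_not]; apply decide_eq_decide.2; omega
      rw [e1, e2]; simp
  · intro x y h1 h2 h3 h4 h5
    rw [SimpleGraph.comap_adj, he, he, Lad_adj hm2]
    simp only [lrel]
    rintro ((h | h | h) | (h | h | h)) <;> omega
  · intro u v
    rw [SimpleGraph.comap_adj]

theorem lad_maxInd {m : ℕ} {τ : Bool} (hm : 2 ≤ m)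
    (h4 : (τ = true ∧ m % 4 = 1) ∨ (τ = false ∧ m % 4 = 3)) :
    LBd (Lad m τ) ((m + 1) / 2) := by
  right
  obtain ⟨k, rfl⟩ : ∃ k, m = 2 * k + 1 := ⟨m / 2, by omega⟩
  let g : Fin (k + 1) → Fin (2 * k + 1) × Bool := fun i =>
    (⟨2 * (i : ℕ), by have := i.2; omega⟩, decide ((i : ℕ) % 2 = 1))
  have hmem : ∀ i (hi : i < k + 1), ((⟨2 * i, by omega⟩, decide (i % 2 = 1)) :
      Fin (2 * k + 1) × Bool) ∈ Finset.univ.image g := by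
    intro i hi
    exact Finset.mem_image.2 ⟨⟨i, hi⟩, Finset.mem_univ _, rfl⟩
  refine ⟨Finset.univ.image g, ?_, ?_, ?_⟩
  · intro u hu v hv
    rw [Finset.mem_image] at hu hv
    obtain ⟨i, -, rfl⟩ := hu
    obtain ⟨j, -, rfl⟩ := hv
    have hi := i.2
    have hj := j.2
    simp only [g]
    rw [Lad_adj hm]
    simp only [lrel]
    have wrap : ∀ i j : ℕ, 2 * i + 1 = 2 * k + 1 → 2 * j = 0 →
        decide (j % 2 = 1) = xor (decide (i % 2 = 1)) τ → False := by
      intro i' j' h1 h2 h3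
      obtain rfl : j' = 0 := by omega
      have hik : i' = k := by omega
      rcases h4 with ⟨rfl, h⟩ | ⟨rfl, h⟩
      · rw [decide_eq_false (show ¬ i' % 2 = 1 by omega)] at h3
        simp at h3
      · rw [decide_eq_true (show i' % 2 = 1 by omega)] at h3
        simp at h3
    have rung : ∀ i j : ℕ, 2 * i = 2 * j → decide (i % 2 = 1) = !decide (j % 2 = 1) → False := by
      intro i j h1 h2
      obtain rfl : i = j := by omega
      simp at h2
    rintro ((h | h | h) | (h | h | h))
    · exact rung _ _ h.1 h.2
    · omega
    · exact wrap _ _ h.1 h.2.1 h.2.2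
    · exact rung _ _ h.1 h.2
    · omega
    · exact wrap _ _ h.1 h.2.1 h.2.2
  · rintro ⟨⟨p, hp⟩, ε⟩ hv
    rcases Nat.even_or_odd' p with ⟨i, rfl | rfl⟩
    · refine ⟨_, hmem i (by omega), ?_⟩
      rw [Lad_adj hm]
      left; left
      refine ⟨rfl, ?_⟩
      by_contra hc
      have : ε = decide (i % 2 = 1) :=
        (show ∀ a b : Bool, ¬ (a = !b) → b = a by decide) _ _ hc
      subst this
      exact hv (hmem i (by omega))
    · by_cases hε : ε = decide (i % 2 = 1)
      · refine ⟨_, hmem i (by omega), ?_⟩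
        rw [Lad_adj hm]
        left; right; left
        exact ⟨hε.symm, rfl⟩
      · refine ⟨_, hmem (i + 1) (by omega), ?_⟩
        rw [Lad_adj hm]
        right; right; left
        refine ⟨?_, by simp only; omega⟩
        have : decide ((i + 1) % 2 = 1) = !decide (i % 2 = 1) := by
          rw [← decide_not]; apply decide_eq_decide.2; omega
        simp only
        rw [this]
        exact (show ∀ a b : Bool, ¬ (a = b) → a = !b by decide) _ _ hε
  · rw [Finset.card_image_of_injective, Finset.card_univ, Fintype.card_fin]
    · omega
    · intro i j h
      simp only [g, Prod.mk.injEq, Fin.mk.injEq] at h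
      apply Fin.ext
      omega

/-- the depth of a component -/
def dep (m : ℕ) (τ : Bool) : ℕ :=
  if (τ = true ∧ m % 4 = 1) ∨ (τ = false ∧ m % 4 = 3) then (m + 1) / 2 else m / 2

theorem lad_win_dep {m : ℕ} {τ : Bool} (hm : 2 ≤ m) : Win (Lad m τ) Finset.univ (dep m τ) := by
  unfold dep
  split_ifs with h
  · exact win_Lad_four hm h
  · exact win_Lad_gen hm

theorem lad_LBd_dep {m : ℕ} {τ : Bool} (hm : 2 ≤ m) : LBd (Lad m τ) (dep m τ) := by
  unfold dep
  split_ifs with h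
  · exact lad_maxInd hm h
  · apply lad_cert (by omega)
    rcases Nat.even_or_odd' m with ⟨k, hk | hk⟩
    · left; omega
    · right
      refine ⟨by omega, ?_⟩
      push Not at h
      cases τ
      · have := h.2 rfl
        symm; apply decide_eq_false; omega
      · have := h.1 rfl
        symm; apply decide_eq_true; omega

end LadLB

set_option linter.unusedSectionVars false
set_option linter.unusedSimpArgs false

section NT

def bz (b : Bool) : ℤ := if b then 1 else 0

theorem circ_adj {n a : ℕ} (ha1 : 1 ≤ a) (han : a < n) (x y : Fin (2 * n)) :
    (circulantGraph (2 * n) ({a, n} : Set ℕ)).Adj x y ↔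
      ((2 * n : ℤ) ∣ (y : ℤ) - x - n ∨ (2 * n : ℤ) ∣ (y : ℤ) - x - a ∨
        (2 * n : ℤ) ∣ (x : ℤ) - y - a) := by
  unfold circulantGraph
  rw [SimpleGraph.fromRel_adj]
  simp only [Set.mem_insert_iff, Set.mem_singleton_iff, ne_eq, Fin.ext_iff]
  have hx := x.2
  have hy := y.2
  have key : ∀ z : ℤ, -(4 * n) < z → z < 2 * n → ((2 * n : ℤ) ∣ z ↔ z = 0 ∨ z = - (2 * n)) := by
    intro z h1 h2
    constructor
    · rintro ⟨k, rfl⟩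
      have hn : (0 : ℤ) < 2 * n := by omega
      have k1 : k < 1 := by
        by_contra hc
        push Not at hc
        have := mul_le_mul_of_nonneg_left hc hn.le
        linarith
      have k2 : -2 < k := by
        by_contra hc
        push Not at hc
        have := mul_le_mul_of_nonneg_left hc hn.le
        linarith
      obtain rfl | rfl : k = 0 ∨ k = -1 := by omega
      · left; ring
      · right; ring
    · rintro (rfl | rfl)
      · exact dvd_zero _
      · exact ⟨-1, by ring⟩
  rw [key _ (by omega) (by omega), key _ (by omega) (by omega), key _ (by omega) (by omega)]
  omega

theorem dvd_core {T m a' : ℕ} (hT : 1 ≤ T) (hm : 1 ≤ m) (hco : Nat.Coprime m a')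
    (γ j e : ℤ) (h1 : -(T : ℤ) < γ) (h2 : γ < T) :
    (2 * (T * m : ℕ) : ℤ) ∣ γ + j * (T * a' : ℕ) + e * (T * m : ℕ) ↔
      γ = 0 ∧ ∃ j', j = m * j' ∧ (2 : ℤ) ∣ a' * j' + e := by
  have hT0 : (T : ℤ) ≠ 0 := by omega
  have hm0 : (m : ℤ) ≠ 0 := by omega
  push_cast
  constructor
  · intro h
    have hγ : γ = 0 := by
      have h3 : (T : ℤ) ∣ γ + j * (T * a') + e * (T * m) :=
        (Dvd.intro _ (by ring : (T : ℤ) * (2 * m) = 2 * (T * m))).trans h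
      have h4 : (T : ℤ) ∣ γ := by
        have h5 : (T : ℤ) ∣ j * (T * a') + e * (T * m) := ⟨j * a' + e * m, by ring⟩
        have := dvd_sub h3 h5
        rwa [show γ + j * (T * a') + e * (T * m) - (j * (T * a') + e * (T * m)) = γ by ring] at this
      refine Int.eq_zero_of_abs_lt_dvd h4 ?_
      rw [abs_lt]; exact ⟨h1, h2⟩
    subst hγ
    refine ⟨rfl, ?_⟩
    have h3 : (2 * m : ℤ) ∣ j * a' + e * m := by
      rw [show 2 * ((T : ℤ) * m) = T * (2 * m) by ring,
        show 0 + j * ((T : ℤ) * a') + e * (T * m) = T * (j * a' + e * m) by ring] at h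
      exact (mul_dvd_mul_iff_left hT0).1 h
    have h4 : (m : ℤ) ∣ j * a' := by
      have h5 : (m : ℤ) ∣ j * a' + e * m := (Dvd.intro_left _ rfl).trans h3
      have := dvd_sub h5 (Dvd.intro_left e rfl : (m : ℤ) ∣ e * m)
      rwa [show j * a' + e * m - e * m = j * (a' : ℤ) by ring] at this
    have h5 : (m : ℤ) ∣ j :=
      IsCoprime.dvd_of_dvd_mul_right (Nat.isCoprime_iff_coprime.2 hco) h4
    obtain ⟨j', rfl⟩ := h5
    refine ⟨j', rfl, ?_⟩
    rw [show (2 : ℤ) * m = m * 2 by ring,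
      show (m : ℤ) * j' * a' + e * m = m * (a' * j' + e) by ring] at h3
    exact (mul_dvd_mul_iff_left hm0).1 h3
  · rintro ⟨rfl, j', rfl, k, hk⟩
    refine ⟨k, ?_⟩
    calc (0 : ℤ) + m * j' * (T * a') + e * (T * m) = T * m * (a' * j' + e) := by ring
      _ = _ := by rw [hk]; ring

theorem small_mul1 {m : ℕ} (hm : 1 ≤ m) {j : ℤ} (h1 : -(m : ℤ) < m * j) (h2 : (m : ℤ) * j < m) :
    j = 0 := by
  have hm0 : (0 : ℤ) ≤ m := by omega
  have k1 : j < 1 := by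
    by_contra hc
    push Not at hc
    have := mul_le_mul_of_nonneg_left hc hm0
    linarith
  have k2 : -1 < j := by
    by_contra hc
    push Not at hc
    have := mul_le_mul_of_nonneg_left hc hm0
    linarith
  omega

theorem small_mul2 {m : ℕ} (hm : 1 ≤ m) {j : ℤ} (h1 : -(m : ℤ) ≤ m * j) (h2 : (m : ℤ) * j < m) :
    j = 0 ∨ j = -1 := by
  have hm0 : (0 : ℤ) ≤ m := by omega
  have hm1 : (0 : ℤ) < m := by omega
  have k1 : j < 1 := by
    by_contra hc
    push Not at hc
    have := mul_le_mul_of_nonneg_left hc hm0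
    linarith
  have k2 : -2 < j := by
    by_contra hc
    push Not at hc
    have := mul_le_mul_of_nonneg_left hc hm0
    linarith
  omega

/-- the vertex map -/
def vmap (T m a' : ℕ) (hn : 0 < 2 * (T * m)) (v : Fin T × (Fin m × Bool)) : Fin (2 * (T * m)) :=
  ⟨((v.1 : ℕ) + (v.2.1 : ℕ) * (T * a') + (if v.2.2 then 1 else 0) * (T * m)) % (2 * (T * m)),
    Nat.mod_lt _ hn⟩

theorem vmap_val (T m a' : ℕ) (hn : 0 < 2 * (T * m)) (v : Fin T × (Fin m × Bool)) :
    ∃ q : ℤ, ((vmap T m a' hn v : ℕ) : ℤ) =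
      (v.1 : ℕ) + (v.2.1 : ℕ) * (T * a' : ℕ) + bz v.2.2 * (T * m : ℕ) + (2 * (T * m : ℕ)) * q := by
  refine ⟨-((((v.1 : ℕ) + (v.2.1 : ℕ) * (T * a') + (if v.2.2 then 1 else 0) * (T * m)) /
    (2 * (T * m)) : ℕ) : ℤ), ?_⟩
  unfold vmap bz
  have := Nat.mod_add_div ((v.1 : ℕ) + (v.2.1 : ℕ) * (T * a') +
    (if v.2.2 then 1 else 0) * (T * m)) (2 * (T * m))
  have h2 := congrArg (Nat.cast : ℕ → ℤ) this
  rw [Nat.cast_add, Nat.cast_mul] at h2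
  simp only
  rw [mul_neg]
  split_ifs at * <;> push_cast at * <;> linarith

theorem vmap_dvd {T m a' : ℕ} (hn : 0 < 2 * (T * m)) (hco : Nat.Coprime m a')
    (u v : Fin T × (Fin m × Bool)) (s r : ℤ) :
    (2 * (T * m : ℕ) : ℤ) ∣ ((vmap T m a' hn v : ℕ) : ℤ) - ((vmap T m a' hn u : ℕ) : ℤ)
      - s * (T * a' : ℕ) - r * (T * m : ℕ) ↔
    u.1 = v.1 ∧ ∃ j' : ℤ, ((v.2.1 : ℕ) : ℤ) - (u.2.1 : ℕ) - s = m * j' ∧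
      (2 : ℤ) ∣ a' * j' + (bz v.2.2 - bz u.2.2 - r) := by
  obtain ⟨q, hq⟩ := vmap_val T m a' hn v
  obtain ⟨q', hq'⟩ := vmap_val T m a' hn u
  have hT : 1 ≤ T := by
    rcases Nat.eq_zero_or_pos T with rfl | h
    · simp at hn
    · exact h
  have hm : 1 ≤ m := by
    rcases Nat.eq_zero_or_pos m with rfl | h
    · simp at hn
    · exact h
  have h1 := v.1.2
  have h2 := u.1.2
  have := dvd_core hT hm hco (((v.1 : ℕ) : ℤ) - (u.1 : ℕ))
    (((v.2.1 : ℕ) : ℤ) - (u.2.1 : ℕ) - s) (bz v.2.2 - bz u.2.2 - r) (by omega) (by omega)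
  rw [hq, hq']
  rw [show ((v.1 : ℕ) : ℤ) + (v.2.1 : ℕ) * (T * a' : ℕ) + bz v.2.2 * (T * m : ℕ) +
      (2 * (T * m : ℕ)) * q - ((u.1 : ℕ) + (u.2.1 : ℕ) * (T * a' : ℕ) + bz u.2.2 * (T * m : ℕ) +
      (2 * (T * m : ℕ)) * q') - s * (T * a' : ℕ) - r * (T * m : ℕ) =
      (((v.1 : ℕ) : ℤ) - (u.1 : ℕ) + (((v.2.1 : ℕ) : ℤ) - (u.2.1 : ℕ) - s) * (T * a' : ℕ) +
      (bz v.2.2 - bz u.2.2 - r) * (T * m : ℕ)) + (2 * (T * m : ℕ)) * (q - q') by ring]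
  rw [dvd_add_left (Dvd.intro _ rfl), this]
  refine and_congr ?_ Iff.rfl
  rw [Fin.ext_iff]
  omega

theorem vmap_bij {T m a' : ℕ} (hn : 0 < 2 * (T * m)) (hco : Nat.Coprime m a') :
    Function.Bijective (vmap T m a' hn) := by
  rw [Fintype.bijective_iff_injective_and_card]
  constructor
  · rintro ⟨c, k, ε⟩ ⟨c', k', ε'⟩ h
    have h0 := (vmap_dvd hn hco (c, k, ε) (c', k', ε') 0 0).1 (by rw [h]; simp)
    obtain ⟨h1, j', h2, h3⟩ := h0
    simp only at h1 h2 h3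
    subst h1
    have hk := k.2
    have hk' := k'.2
    obtain rfl := small_mul1 (show 1 ≤ m by omega) (show -(m : ℤ) < m * j' by omega) (by omega)
    have hkk : k = k' := Fin.ext (by rw [mul_zero] at h2; omega)
    subst hkk
    have : ε = ε' := by
      cases ε <;> cases ε' <;> simp [bz] at h3 ⊢ <;> omega
    rw [this]
  · simp; ring

theorem vmap_adj {T m a' : ℕ} (hn : 0 < 2 * (T * m)) (hco : Nat.Coprime m a') (hm : 2 ≤ m)
    (ha1 : 1 ≤ T * a') (han : T * a' < T * m) (u v : Fin T × (Fin m × Bool)) :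
    (circulantGraph (2 * (T * m)) ({T * a', T * m} : Set ℕ)).Adj (vmap T m a' hn u)
      (vmap T m a' hn v) ↔ (Cop T (Lad m (decide (a' % 2 = 1)))).Adj u v := by
  have step : ∀ (i j : Fin m) (ε δ : Bool),
      (∃ j' : ℤ, ((j : ℕ) : ℤ) - (i : ℕ) - 1 = m * j' ∧ (2 : ℤ) ∣ a' * j' + (bz δ - bz ε - 0)) ↔
      ((ε = δ ∧ (i : ℕ) + 1 = j) ∨ ((i : ℕ) + 1 = m ∧ (j : ℕ) = 0 ∧
        δ = xor ε (decide (a' % 2 = 1)))) := by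
    intro i j ε δ
    have hi := i.2
    have hj := j.2
    have ht : δ = xor ε (decide (a' % 2 = 1)) ↔ (2 : ℤ) ∣ a' * (-1) + (bz δ - bz ε - 0) := by
      rcases Nat.mod_two_eq_zero_or_one a' with h | h
      · rw [h]; cases ε <;> cases δ <;> simp [bz] <;> omega
      · rw [h]; cases ε <;> cases δ <;> simp [bz] <;> omega
    have hs : ε = δ ↔ (2 : ℤ) ∣ a' * 0 + (bz δ - bz ε - 0) := by
      cases ε <;> cases δ <;> simp [bz] <;> omega
    rw [ht, hs]
    constructor
    · rintro ⟨j', h1, h2⟩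
      obtain rfl | rfl := small_mul2 (show 1 ≤ m by omega) (show -(m : ℤ) ≤ m * j' by omega)
        (by omega)
      · left; exact ⟨h2, by rw [mul_zero] at h1; omega⟩
      · right; exact ⟨by omega, by omega, h2⟩
    · rintro (⟨h1, h2⟩ | ⟨h1, h2, h3⟩)
      · exact ⟨0, by rw [mul_zero]; omega, h1⟩
      · exact ⟨-1, by omega, h3⟩
  have rung : ∀ (i j : Fin m) (ε δ : Bool),
      (∃ j' : ℤ, ((j : ℕ) : ℤ) - (i : ℕ) - 0 = m * j' ∧ (2 : ℤ) ∣ a' * j' + (bz δ - bz ε - 1)) ↔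
      ((i : ℕ) = j ∧ ε = !δ) := by
    intro i j ε δ
    have hi := i.2
    have hj := j.2
    have hs : (ε = !δ) ↔ (2 : ℤ) ∣ a' * 0 + (bz δ - bz ε - 1) := by
      cases ε <;> cases δ <;> simp [bz]
    rw [hs]
    constructor
    · rintro ⟨j', h1, h2⟩
      obtain rfl := small_mul1 (show 1 ≤ m by omega) (show -(m : ℤ) < m * j' by omega)
        (by omega)
      exact ⟨by rw [mul_zero] at h1; omega, h2⟩
    · rintro ⟨h1, h2⟩
      exact ⟨0, by rw [mul_zero]; omega, h2⟩
  rw [circ_adj ha1 han]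
  obtain ⟨c, i, ε⟩ := u
  obtain ⟨c', j, δ⟩ := v
  have e1 := vmap_dvd hn hco (c, i, ε) (c', j, δ) 0 1
  have e2 := vmap_dvd hn hco (c, i, ε) (c', j, δ) 1 0
  have e3 := vmap_dvd hn hco (c', j, δ) (c, i, ε) 1 0
  simp only [zero_mul, one_mul, sub_zero] at e1 e2 e3
  simp only [sub_zero] at step rung
  rw [e1, e2, e3]
  simp only [rung, step]
  show _ ↔ c = c' ∧ (Lad m _).Adj (i, ε) (j, δ)
  rw [Lad_adj hm]
  simp only [lrel]
  constructor
  · rintro (⟨rfl, h⟩ | ⟨rfl, h⟩ | ⟨rfl, h⟩)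
    · exact ⟨rfl, Or.inl (Or.inl h)⟩
    · exact ⟨rfl, Or.inl (Or.inr h)⟩
    · exact ⟨rfl, Or.inr (Or.inr h)⟩
  · rintro ⟨rfl, (h | h) | (h | h)⟩
    · exact Or.inl ⟨rfl, h⟩
    · exact Or.inr (Or.inl ⟨rfl, h⟩)
    · refine Or.inl ⟨rfl, h.1.symm, ?_⟩
      rw [h.2]; simp
    · exact Or.inr (Or.inr ⟨rfl, h⟩)

theorem pdim_circ (K : Type*) [Field K] {n a T m a' : ℕ} (hn : n = T * m) (ha : a = T * a')
    (hco : Nat.Coprime m a') (hm : 2 ≤ m) (ha1 : 1 ≤ a) (han : a < n) :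
    pdimQuot (edgeIdeal K (circulantGraph (2 * n) ({a, n} : Set ℕ))) =
      2 * n - T * dep m (decide (a' % 2 = 1)) := by
  subst hn ha
  have hpos : 0 < 2 * (T * m) := by omega
  have := pdim_of_comp K (lad_win_dep hm) (lad_LBd_dep hm)
    (Equiv.ofBijective _ (vmap_bij hpos hco))
    (H := circulantGraph (2 * (T * m)) ({T * a', T * m} : Set ℕ))
    (fun u v => vmap_adj hpos hco hm ha1 han u v)
  rwa [Fintype.card_fin] at this

end NT

theorem pdim_cubic_circulant (n a t : ℕ) (hn : 2 ≤ n) (ha1 : 1 ≤ a) (han : a < n)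
    (ht : t = Nat.gcd (2 * n) a) (K : Type*) [Field K] :
    (Even (2 * n / t) →
      ((n / t) % 4 = 1 → pdimQuot (edgeIdeal K (circulantGraph (2 * n) ({a, n} : Set ℕ))) = 2 * n - ⌈(n : ℚ) / (2 * (t : ℚ))⌉₊ * t) ∧
      ((n / t) % 4 ≠ 1 → pdimQuot (edgeIdeal K (circulantGraph (2 * n) ({a, n} : Set ℕ))) = 2 * n - ⌈((n : ℚ) - (t : ℚ)) / (2 * (t : ℚ))⌉₊ * t)) ∧
    (¬ Even (2 * n / t) →
      ((2 * n / t) % 4 = 1 → pdimQuot (edgeIdeal K (circulantGraph (2 * n) ({a, n} : Set ℕ))) = 2 * n - ⌈(2 * (n : ℚ) - (t : ℚ)) / (2 * (t : ℚ))⌉₊ * (t / 2)) ∧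
      ((2 * n / t) % 4 = 3 → pdimQuot (edgeIdeal K (circulantGraph (2 * n) ({a, n} : Set ℕ))) = 2 * n - ⌈(n : ℚ) / (t : ℚ)⌉₊ * (t / 2))) := by
  have htpos : 0 < t := by rw [ht]; exact Nat.gcd_pos_of_pos_right _ (by omega)
  have hceil : ∀ (p q c : ℕ), 0 < q → (p : ℚ) ≤ c * q → ((c : ℚ) - 1) * q < p → ⌈(p : ℚ) / q⌉₊ = c := by
    intro p q c hq h1 h2
    have hq' : (0 : ℚ) < q := by exact_mod_cast hq
    rcases Nat.eq_zero_or_pos c with rfl | hc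
    · rw [Nat.ceil_eq_zero, div_le_iff₀ hq']; simpa using h1
    · rw [Nat.ceil_eq_iff (by omega), div_le_iff₀ hq', lt_div_iff₀ hq']
      refine ⟨?_, h1⟩
      rw [Nat.cast_sub (by omega)]; simpa using h2
  have hco0 : Nat.Coprime (2 * n / t) (a / t) := by
    subst ht; exact Nat.coprime_div_gcd_div_gcd htpos
  have hd1 : t ∣ 2 * n := by rw [ht]; exact Nat.gcd_dvd_left _ _
  have hd2 : t ∣ a := by rw [ht]; exact Nat.gcd_dvd_right _ _
  obtain ⟨M, hM⟩ := hd1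
  obtain ⟨A, hA⟩ := hd2
  have hMd : 2 * n / t = M := by rw [hM]; exact Nat.mul_div_cancel_left _ htpos
  have hAd : a / t = A := by rw [hA]; exact Nat.mul_div_cancel_left _ htpos
  rw [hMd, hAd] at hco0
  have htq : (0 : ℚ) < t := by exact_mod_cast htpos
  rw [hMd]
  constructor
  · rintro ⟨m, hm⟩
    have hnm : n = t * m := by
      have : 2 * n = 2 * (t * m) := by rw [hM, hm]; ring
      omega
    have hnt : n / t = m := by rw [hnm]; exact Nat.mul_div_cancel_left _ htpos
    have hAm : A < m := by
      have : t * A < t * m := by omega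
      exact lt_of_mul_lt_mul_left this (Nat.zero_le _)
    have hA1 : 1 ≤ A := by
      rcases Nat.eq_zero_or_pos A with rfl | h
      · simp at hA; omega
      · exact h
    have hAodd : A % 2 = 1 := by
      rcases Nat.mod_two_eq_zero_or_one A with h | h
      · exfalso
        have : 2 ∣ Nat.gcd M A := Nat.dvd_gcd ⟨m, by omega⟩ (Nat.dvd_of_mod_eq_zero h)
        rw [hco0] at this
        omega
      · exact h
    have hco : Nat.Coprime m A := Nat.Coprime.coprime_dvd_left ⟨2, by omega⟩ hco0
    have main := pdim_circ K hnm hA hco (by omega) ha1 han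
    rw [hnt, main, hAodd]
    have hnq : (n : ℚ) = t * m := by rw [hnm]; push_cast; ring
    constructor
    · intro h4
      have : ⌈(n : ℚ) / (2 * (t : ℚ))⌉₊ = (m + 1) / 2 := by
        have e : (n : ℚ) / (2 * (t : ℚ)) = (m : ℕ) / (2 : ℕ) := by
          rw [hnq]; push_cast; field_simp
        rw [e]
        obtain ⟨k, rfl⟩ : ∃ k, m = 2 * k + 1 := ⟨m / 2, by omega⟩
        rw [show (2 * k + 1 + 1) / 2 = k + 1 by omega]
        apply hceil _ _ _ (by omega) <;> push_cast <;> linarith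
      rw [this, mul_comm t]
      simp [dep, h4]
    · intro h4
      have : ⌈((n : ℚ) - (t : ℚ)) / (2 * (t : ℚ))⌉₊ = m / 2 := by
        obtain ⟨k, rfl⟩ : ∃ k, m = k + 1 := ⟨m - 1, by omega⟩
        have e : ((n : ℚ) - t) / (2 * (t : ℚ)) = (k : ℕ) / (2 : ℕ) := by
          rw [hnq]; push_cast; field_simp; ring
        rw [e]
        rcases Nat.even_or_odd' k with ⟨j, rfl | rfl⟩
        · rw [show (2 * j + 1) / 2 = j by omega]
          apply hceil _ _ _ (by omega) <;> push_cast <;> linarith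
        · rw [show (2 * j + 1 + 1) / 2 = j + 1 by omega]
          apply hceil _ _ _ (by omega) <;> push_cast <;> linarith
      rw [this, mul_comm t]
      simp [dep, h4]
  · intro hodd
    have hModd : M % 2 = 1 := Nat.odd_iff.1 (Nat.not_even_iff_odd.1 hodd)
    obtain ⟨T, hT⟩ : 2 ∣ t := by
      have h1 : 2 ∣ t * M := ⟨n, hM.symm⟩
      rcases (Nat.Prime.dvd_mul Nat.prime_two).1 h1 with h | h
      · exact h
      · omega
    have hT2 : t / 2 = T := by omega
    have hnm : n = T * M := by
      have : 2 * n = 2 * (T * M) := by rw [hM, hT]; ring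
      omega
    have hA' : a = T * (2 * A) := by rw [hA, hT]; ring
    have hA1 : 1 ≤ A := by
      rcases Nat.eq_zero_or_pos A with rfl | h
      · simp at hA; omega
      · exact h
    have hAm : 2 * A < M := by
      have : T * (2 * A) < T * M := by omega
      exact lt_of_mul_lt_mul_left this (Nat.zero_le _)
    have hco : Nat.Coprime M (2 * A) :=
      Nat.Coprime.mul_right (Nat.coprime_two_right.2 (Nat.not_even_iff_odd.1 hodd)) hco0
    have main := pdim_circ K hnm hA' hco (by omega) ha1 han
    rw [main, hT2, show 2 * A % 2 = 0 by omega]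
    have hnq : 2 * (n : ℚ) = t * M := by exact_mod_cast hM
    have hnq' : (n : ℚ) = t * M / 2 := by linarith
    constructor
    · intro h4
      have : ⌈(2 * (n : ℚ) - (t : ℚ)) / (2 * (t : ℚ))⌉₊ = M / 2 := by
        obtain ⟨k, rfl⟩ : ∃ k, M = 2 * k + 1 := ⟨M / 2, by omega⟩
        have e : (2 * (n : ℚ) - t) / (2 * (t : ℚ)) = (k : ℕ) / (1 : ℕ) := by
          rw [hnq]; push_cast; field_simp; ring
        rw [e, show (2 * k + 1) / 2 = k by omega]
        apply hceil _ _ _ (by omega) <;> push_cast <;> linarith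
      rw [this, mul_comm T]
      simp [dep, h4]
    · intro h4
      have : ⌈(n : ℚ) / (t : ℚ)⌉₊ = (M + 1) / 2 := by
        obtain ⟨k, rfl⟩ : ∃ k, M = 2 * k + 1 := ⟨M / 2, by omega⟩
        have e : (n : ℚ) / (t : ℚ) = (2 * k + 1 : ℕ) / (2 : ℕ) := by
          rw [hnq']; push_cast; field_simp
        rw [e, show (2 * k + 1 + 1) / 2 = k + 1 by omega]
        apply hceil _ _ _ (by omega) <;> push_cast <;> linarith
      rw [this, mul_comm T]
      simp [dep, h4]
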